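/- Let 3/π < c < 1 and fix k' ∈ {0,4,6,8,10,14}. Then there exists L = L(c,k') such that for all ℓ > L and all m with cℓ < m ≤ ℓ − 1, at least one zero of the Miller basis form f_{12ℓ+k', m} is not on the arc 𝒜, i.e., at least one zero of its Faber polynomial lies outside [0,1728]. -/

import Mathlib

open Complex Polynomial Real MeasureTheory Filter Topology

noncomputable section

/-- `q = e^{2πiz}`. -/
def qexp (z : ℂ) : ℂ := Complex.exp (2 * Real.pi * Complex.I * z)

/-- The normalized Eisenstein series `E_k(z) = (1/2) ∑_{gcd(c,d)=1} (cz+d)^{-k}`,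
with the convention `E_0 = 1`. -/
def Eis (k : ℕ) (z : ℂ) : ℂ :=
  if k = 0 then 1
  else (1 / 2) * ∑' p : ℤ × ℤ, if Int.gcd p.1 p.2 = 1 then 1 / ((p.1 : ℂ) * z + (p.2 : ℂ)) ^ k else 0

/-- The modular discriminant `Δ(z) = q ∏_{n ≥ 1} (1 - q^n)^24`, `q = e^{2πiz}`. -/
def Disc (z : ℂ) : ℂ := qexp z * ∏' n : ℕ, (1 - qexp z ^ (n + 1)) ^ 24

/-- The modular `j`-invariant `j = E₄³ / Δ`. -/
def jinv (z : ℂ) : ℂ := Eis 4 z ^ 3 / Disc z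

/-- The coefficient of `q^d` in the Fourier/`q`-expansion of a `1`-periodic function
holomorphic on the upper half-plane, computed at height `1`. -/
def qCoeff (f : ℂ → ℂ) (d : ℤ) : ℂ :=
  ∫ x in (0:ℝ)..1,
    f (x + Complex.I) * Complex.exp (-(2 * Real.pi * Complex.I * d * (x + Complex.I)))

/-- `c_N(d)`: the coefficient of `q^d` in the Laurent expansion of `j^N`. -/
def cj (N : ℕ) (d : ℤ) : ℂ := qCoeff (fun z => jinv z ^ N) d

/-- `A_n = (1/2π) ∫_{π/2}^{2π/3} j(e^{iθ})^n dθ`. -/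
def Acoef (n : ℕ) : ℂ :=
  (1 / (2 * Real.pi)) *
    ∫ θ in (Real.pi / 2)..(2 * Real.pi / 3), jinv (Complex.exp (θ * Complex.I)) ^ n

/-- `B_n = -c_n(0)`, where `c_n(0)` is the coefficient of `q^0` in `j^n`. -/
def Bcoef (n : ℕ) : ℂ := - cj n 0

/-- `C_n(k') = 0` for `k' ∈ {0,4,8}` and `C_n(k') = -1728^n/2` for `k' ∈ {6,10,14}`. -/
def Ccoef (n k' : ℕ) : ℂ := if k' = 6 ∨ k' = 10 ∨ k' = 14 then -(1728 : ℂ) ^ n / 2 else 0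

/-- Real-valued version of `A_n` (recall `j` is real on the arc). -/
def AcoefR (n : ℕ) : ℝ :=
  (1 / (2 * Real.pi)) *
    ∫ θ in (Real.pi / 2)..(2 * Real.pi / 3), (jinv (Complex.exp (θ * Complex.I)) ^ n).re

/-- Real-valued version of `B_n = -c_n(0)` (recall `c_n(0)` is an integer). -/
def BcoefR (n : ℕ) : ℝ := - (cj n 0).re

/-- Real-valued version of `C_n(k')`. -/
def CcoefR (n k' : ℕ) : ℝ := if k' = 6 ∨ k' = 10 ∨ k' = 14 then -(1728 : ℝ) ^ n / 2 else 0

/-- `f` is the `m`-th element `f_{k,m} = q^m + O(q^{ℓ+1})` of the Miller basis of `M_k`,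
`k = 12ℓ + k'`: it is holomorphic on the upper half-plane, weight-`k` modular for
`SL₂(ℤ)`, and has a convergent `q`-expansion whose coefficients in degrees `≤ ℓ`
are `δ_{d,m}`. -/
def IsMillerForm (ℓ k' m : ℕ) (f : ℂ → ℂ) : Prop :=
  (∀ z : ℂ, 0 < z.im → DifferentiableAt ℂ f z) ∧
  (∀ z : ℂ, 0 < z.im → f (z + 1) = f z) ∧
  (∀ z : ℂ, 0 < z.im → f (-1 / z) = z ^ (12 * ℓ + k') * f z) ∧
  (∃ a : ℕ → ℂ,
    (∀ z : ℂ, 0 < z.im →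
      Summable (fun n : ℕ => a n * qexp z ^ n) ∧ f z = ∑' n : ℕ, a n * qexp z ^ n) ∧
    (∀ d : ℕ, d ≤ ℓ → a d = if d = m then 1 else 0))

/-- `F` is the Faber polynomial of `f = f_{k,m}`, `k = 12ℓ + k'`: the monic polynomial
of degree `ℓ - m` with `f = Δ^ℓ ⬝ E_{k'} ⬝ F(j)`. -/
def IsFaber (ℓ k' m : ℕ) (f : ℂ → ℂ) (F : Polynomial ℂ) : Prop :=
  F.Monic ∧ F.natDegree = ℓ - m ∧
  ∀ z : ℂ, 0 < z.im → f z = Disc z ^ ℓ * Eis k' z * F.eval (jinv z)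

/-- The sum of the `n`-th powers of the zeros of `F`, counted with multiplicity. -/
def powerSumRoots (F : Polynomial ℂ) (n : ℕ) : ℂ := (F.roots.map (fun x => x ^ n)).sum

/-- The (finite) solutions of `d_1 + 2 d_2 + ⋯ + n d_n = n` in nonnegative integers,
indexed by `Fin n` (so index `t : Fin n` stands for `d_{t+1}`).  Note any solution
automatically has `d_t ≤ n`. -/
def sols (n : ℕ) : Finset (Fin n → ℕ) :=
  (Fintype.piFinset fun _ : Fin n => Finset.range (n + 1)).filter
    (fun d => ∑ t : Fin n, ((t : ℕ) + 1) * d t = n)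

open UpperHalfPlane ModularForm EisensteinSeries in
lemma eis_eq (k : ℕ) (hk : 3 ≤ k) (z : UpperHalfPlane) : Eis k z = ModularForm.E hk z := by
  have h1 : ModularForm.E hk z = (1/2 : ℂ) * eisensteinSeries (N := 1) 0 k z := rfl
  rw [h1, Eis, if_neg (by omega), eisensteinSeries]
  congr 1
  rw [← (finTwoArrowEquiv ℤ).tsum_eq, tsum_subtype (gammaSet 1 1 0) (fun x => eisSummand k x z)]
  apply tsum_congr
  intro v
  simp only [Set.indicator, gammaSet_one_mem_iff, eisSummand, finTwoArrowEquiv_apply]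
  split_ifs <;> simp_all

def E2c (z : ℂ) : ℂ := EisensteinSeries.E2 (UpperHalfPlane.ofComplex z)

abbrev imTop : Filter ℂ := Filter.comap Complex.im Filter.atTop

lemma disc_eq (z : UpperHalfPlane) : Disc z = ModularForm.discriminant z := by
  rw [ModularForm.discriminant_eq_q_prod]
  simp [Disc, qexp, ModularForm.eta_q_eq_pow, Function.Periodic.qParam]

lemma differentiableAt_of_mdiff {g : UpperHalfPlane → ℂ} 
   (hg : MDifferentiable (modelWithCornersSelf ℂ ℂ) (modelWithCornersSelf ℂ ℂ) g) {h : ℂ → ℂ} (hh : ∀ z : UpperHalfPlane, h z = g z)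
   {z : ℂ} (hz : 0 < z.im) : DifferentiableAt ℂ h z := by
  have := (UpperHalfPlane.mdifferentiable_iff.mp hg).differentiableAt (UpperHalfPlane.isOpen_upperHalfPlaneSet.mem_nhds hz)
  refine this.congr_of_eventuallyEq ?_
  filter_upwards [UpperHalfPlane.isOpen_upperHalfPlaneSet.mem_nhds hz] with w hw
  simp [UpperHalfPlane.ofComplex_apply_of_im_pos hw, ← hh]

lemma eis_diff (k : ℕ) (hk : 3 ≤ k) {z : ℂ} (hz : 0 < z.im) : DifferentiableAt ℂ (Eis k) z :=
  differentiableAt_of_mdiff (ModularFormClass.holo (ModularForm.E hk)) (eis_eq k hk) hz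

lemma disc_diff {z : ℂ} (hz : 0 < z.im) : DifferentiableAt ℂ Disc z :=
  differentiableAt_of_mdiff (ModularFormClass.holo CuspForm.discriminant) (disc_eq) hz

lemma E2c_diff {z : ℂ} (hz : 0 < z.im) : DifferentiableAt ℂ E2c z :=
  differentiableAt_of_mdiff _root_.E2_mdifferentiable (fun z => by simp [E2c]) hz

lemma slash_T_apply (g : UpperHalfPlane → ℂ) (k : ℤ) {z : ℂ} (hz : 0 < z.im) :
    (SlashAction.map k ModularGroup.T g) ⟨z, hz⟩ = g (UpperHalfPlane.ofComplex (z + 1)) := by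
  rw [ModularForm.SL_slash_apply, UpperHalfPlane.modular_T_smul]
  have h1 : (1 : ℝ) +ᵥ (⟨z, hz⟩ : UpperHalfPlane) = UpperHalfPlane.ofComplex (z + 1) := by
    rw [UpperHalfPlane.ofComplex_apply_of_im_pos (by simpa using hz)]
    ext; simp [add_comm]
  rw [h1]
  erw [ModularGroup.denom_apply]
  simp [ModularGroup.T]

lemma neg_one_div_im_pos {z : ℂ} (hz : 0 < z.im) : 0 < (-1 / z).im := by
  rw [neg_div, one_div, ← inv_neg]; simpa using UpperHalfPlane.im_inv_neg_coe_pos ⟨z, hz⟩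

lemma slash_S_apply (g : UpperHalfPlane → ℂ) (k : ℤ) {z : ℂ} (hz : 0 < z.im) :
    (SlashAction.map k ModularGroup.S g) ⟨z, hz⟩ = g (UpperHalfPlane.ofComplex (-1 / z)) * z ^ (-k) := by
  rw [ModularForm.SL_slash_apply, UpperHalfPlane.modular_S_smul]
  have h1 : UpperHalfPlane.mk (-((⟨z, hz⟩ : UpperHalfPlane) : ℂ))⁻¹ (UpperHalfPlane.im_inv_neg_coe_pos ⟨z, hz⟩) = UpperHalfPlane.ofComplex (-1 / z) := by
    rw [UpperHalfPlane.ofComplex_apply_of_im_pos (neg_one_div_im_pos hz)]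
    ext; simp [neg_div, inv_neg]
  rw [h1]
  erw [ModularGroup.denom_S]

lemma SL_inv {F : Type*} [FunLike F UpperHalfPlane ℂ] {k : ℤ} [SlashInvariantFormClass F (Matrix.SpecialLinearGroup.mapGL (n := Fin 2) (R := ℤ) ℝ).range k] (f : F) (γ : Matrix.SpecialLinearGroup (Fin 2) ℤ) : SlashAction.map k γ (f : UpperHalfPlane → ℂ) = f := by
  rw [ModularForm.SL_slash]
  exact SlashInvariantForm.slash_action_eqn f _ ⟨γ, rfl⟩

lemma eis_ofC (k : ℕ) (hk : 3 ≤ k) {z : ℂ} (hz : 0 < z.im) : ModularForm.E hk (UpperHalfPlane.ofComplex z) = Eis k z := by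
  rw [← eis_eq, UpperHalfPlane.ofComplex_apply_of_im_pos hz]

lemma disc_ofC {z : ℂ} (hz : 0 < z.im) : CuspForm.discriminant (UpperHalfPlane.ofComplex z) = Disc z := by
  rw [CuspForm.coe_discriminant, ← disc_eq, UpperHalfPlane.ofComplex_apply_of_im_pos hz]

lemma im_ne {z : ℂ} (hz : 0 < z.im) : z ≠ 0 := by rintro rfl; simp at hz

lemma eis_per (k : ℕ) (hk : 3 ≤ k) {z : ℂ} (hz : 0 < z.im) : Eis k (z + 1) = Eis k z := by
  have := congrFun (SL_inv (ModularForm.E hk) ModularGroup.T) ⟨z, hz⟩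
  rw [slash_T_apply, eis_ofC k hk (by simpa using hz), ← eis_eq] at this
  exact this

lemma eis_S (k : ℕ) (hk : 3 ≤ k) {z : ℂ} (hz : 0 < z.im) : Eis k (-1 / z) = z ^ k * Eis k z := by
  have := congrFun (SL_inv (ModularForm.E hk) ModularGroup.S) ⟨z, hz⟩
  rw [slash_S_apply, eis_ofC k hk (neg_one_div_im_pos hz), ← eis_eq] at this
  have hz0 := im_ne hz
  rw [← show _ = Eis k z from this, zpow_neg]; norm_cast; field_simp

lemma disc_per {z : ℂ} : Disc (z + 1) = Disc z := by
  simp [Disc, qexp, mul_add, Complex.exp_add]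

lemma disc_S {z : ℂ} (hz : 0 < z.im) : Disc (-1 / z) = z ^ 12 * Disc z := by
  have := congrFun (SL_inv CuspForm.discriminant ModularGroup.S) ⟨z, hz⟩
  rw [slash_S_apply, disc_ofC (neg_one_div_im_pos hz), CuspForm.coe_discriminant, ← disc_eq] at this
  have hz0 := im_ne hz
  rw [← show _ = Disc z from this, zpow_neg]; norm_cast; field_simp

lemma E2c_per {z : ℂ} (hz : 0 < z.im) : E2c (z + 1) = E2c z := by
  have := congrFun (EisensteinSeries.E2_slash_action ModularGroup.T) ⟨z, hz⟩
  rw [EisensteinSeries.D2_T, slash_T_apply] at this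
  simpa [E2c, UpperHalfPlane.ofComplex_apply_of_im_pos hz] using this

lemma E2c_S {z : ℂ} (hz : 0 < z.im) : E2c (-1 / z) = z ^ 2 * E2c z + 6 * z / (π * I) := by
  have := congrFun (EisensteinSeries.E2_slash_action ModularGroup.S) ⟨z, hz⟩
  rw [slash_S_apply] at this
  simp only [Pi.sub_apply, Pi.smul_apply, EisensteinSeries.D2_S, riemannZeta_two] at this
  have hz0 := im_ne hz
  have hpi : (π : ℂ) ≠ 0 := by exact_mod_cast Real.pi_ne_zero
  simp only [E2c, UpperHalfPlane.ofComplex_apply_of_im_pos hz]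
  have h2 : EisensteinSeries.E2 (UpperHalfPlane.ofComplex (-1 / z)) = z^2 * (EisensteinSeries.E2 (UpperHalfPlane.ofComplex (-1 / z)) * z ^ (-2:ℤ)) := by
    rw [zpow_neg]; norm_cast; field_simp
  rw [h2, this]
  simp only [smul_eq_mul]
  field_simp
  ring_nf
  simp [I_sq]
  ring

lemma disc_ne {z : ℂ} (hz : 0 < z.im) : Disc z ≠ 0 := by
  have := ModularForm.discriminant_ne_zero ⟨z, hz⟩
  rwa [← disc_eq] at this

lemma disc_eq_E {z : ℂ} (hz : 0 < z.im) : 1728 * Disc z = Eis 4 z ^ 3 - Eis 6 z ^ 2 := by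
  have := ModularForm.discriminant_eq_E₄_cube_sub_E₆_sq ⟨z, hz⟩
  rw [← disc_eq, ← eis_eq, ← eis_eq] at this
  rw [show Disc z = _ from this]; ring_nf

lemma disc_deriv {z : ℂ} (hz : 0 < z.im) : HasDerivAt Disc (2 * π * I * E2c z * Disc z) z := by
  have h1 := ModularForm.logDeriv_eta_eq_E2 ⟨z, hz⟩
  have h2 := (ModularForm.differentiableAt_eta_of_mem_upperHalfPlaneSet hz).hasDerivAt.pow 24
  have h0 := ModularForm.eta_ne_zero hz
  have h3 : HasDerivAt Disc (24 * ModularForm.eta z ^ 23 * deriv ModularForm.eta z) z := by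
    refine (h2.congr_deriv (by norm_num)).congr_of_eventuallyEq ?_
    filter_upwards [UpperHalfPlane.isOpen_upperHalfPlaneSet.mem_nhds hz] with w hw
    exact disc_eq ⟨w, hw⟩
  convert h3 using 1
  rw [show Disc z = _ from disc_eq ⟨z, hz⟩, ModularForm.discriminant, E2c, UpperHalfPlane.ofComplex_apply_of_im_pos hz]
  simp only [logDeriv_apply] at h1
  rw [div_eq_iff h0] at h1
  rw [h1]; ring

lemma imTop_ev (Y : ℝ) : ∀ᶠ z in imTop, Y < z.im :=
  (tendsto_comap (f := Complex.im) (x := atTop)).eventually (eventually_gt_atTop Y)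

lemma deriv_tendsto {g : ℂ → ℂ} {L : ℂ} {Y0 : ℝ} (hd : ∀ z : ℂ, Y0 < z.im → DifferentiableAt ℂ g z)
    (hg : Tendsto g imTop (𝓝 L)) : Tendsto (deriv g) imTop (𝓝 0) := by
  rw [Metric.tendsto_nhds] at hg ⊢
  intro ε hε
  have h1 := hg (ε / 2) (by positivity)
  rw [eventually_comap, eventually_atTop] at h1
  obtain ⟨Y, hY⟩ := h1
  filter_upwards [imTop_ev (max Y Y0 + 1)] with z hz
  rw [dist_zero_right]
  have him : ∀ w ∈ Metric.closedBall z 1, max Y Y0 < w.im := by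
    intro w hw
    have h2 : |(w - z).im| ≤ 1 := (Complex.abs_im_le_norm _).trans (by simpa [dist_eq_norm] using hw)
    rw [Complex.sub_im, abs_le] at h2
    linarith [h2.1]
  have h3 : ‖deriv (fun w => g w - L) z‖ ≤ (ε / 2) / 1 := by
    apply Complex.norm_deriv_le_of_forall_mem_sphere_norm_le one_pos
    · apply DifferentiableOn.diffContOnCl
      rw [closure_ball z one_ne_zero]
      intro w hw
      exact ((hd w ((le_max_right _ _).trans_lt (him w hw))).sub_const L).differentiableWithinAt
    · intro w hw
      have := hY w.im ((le_max_left _ _).trans (him w (Metric.sphere_subset_closedBall hw)).le) w rfl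
      rw [dist_eq_norm] at this
      exact this.le
  rw [deriv_sub_const] at h3
  linarith

def lineInt (g : ℂ → ℂ) (Y : ℝ) : ℂ := ∫ x in (0:ℝ)..1, g (x + Y * I)

lemma int_indep {g : ℂ → ℂ} {Y0 : ℝ} (hd : ∀ z : ℂ, Y0 < z.im → DifferentiableAt ℂ g z)
    (hp : ∀ z : ℂ, Y0 < z.im → g (z + 1) = g z) {a b : ℝ} (ha : Y0 < a) (hb : Y0 < b) :
    lineInt g a = lineInt g b := by
  have := Complex.integral_boundary_rect_eq_zero_of_differentiableOn g (a * I) (1 + b * I) ?_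
  · simp at this
    have h2 : ∀ y ∈ Set.uIcc a b, g (1 + y * I) = g (y * I) := by
      intro y hy
      rw [add_comm, hp]
      have : min a b ≤ y := hy.1
      have : Y0 < min a b := lt_min ha hb
      simp; linarith
    rw [intervalIntegral.integral_congr h2] at this
    simp only [lineInt]
    linear_combination this
  · intro z hz
    apply (hd z _).differentiableWithinAt
    have := hz.2
    simp at this
    have h1 : min a b ≤ z.im := this.1
    have : Y0 < min a b := lt_min ha hb
    linarith

lemma lineInt_cont {g : ℂ → ℂ} {Y0 : ℝ} (hd : ∀ z : ℂ, Y0 < z.im → DifferentiableAt ℂ g z) {a : ℝ} (ha : Y0 < a) :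
    Continuous (fun x : ℝ => g (x + a * I)) := by
  rw [continuous_iff_continuousAt]
  intro x
  have := (hd (x + a * I) (by simpa using ha)).continuousAt
  exact ContinuousAt.comp (f := fun x : ℝ => (x + a * I : ℂ)) this (by fun_prop)

lemma int_lim {g : ℂ → ℂ} {L : ℂ} {Y0 : ℝ} (hd : ∀ z : ℂ, Y0 < z.im → DifferentiableAt ℂ g z)
    (hp : ∀ z : ℂ, Y0 < z.im → g (z + 1) = g z) (hg : Tendsto g imTop (𝓝 L)) {a : ℝ} (ha : Y0 < a) :
    lineInt g a = L := by
  refine eq_of_forall_dist_le ?_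
  intro ε hε
  rw [Metric.tendsto_nhds] at hg
  have h1 := hg ε hε
  rw [eventually_comap, eventually_atTop] at h1
  obtain ⟨Y, hY⟩ := h1
  rw [int_indep hd hp ha (lt_max_of_lt_right ha : Y0 < max Y a)]
  have hc := lineInt_cont hd (lt_max_of_lt_right ha : Y0 < max Y a)
  have h2 : lineInt g (max Y a) - L = ∫ x in (0:ℝ)..1, (g (x + (max Y a : ℝ) * I) - L) := by
    rw [intervalIntegral.integral_sub (hc.intervalIntegrable _ _) (by simp)]
    simp [lineInt]
  rw [dist_eq_norm, h2]
  have := intervalIntegral.norm_integral_le_of_norm_le_const (a := (0:ℝ)) (b := 1) (C := ε)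
    (f := fun x : ℝ => (g (x + (max Y a : ℝ) * I) - L)) ?_
  · simpa using this
  · intro x _
    have := hY (max Y a) (le_max_left _ _) (x + (max Y a : ℝ) * I) (by simp)
    rw [dist_eq_norm] at this
    exact this.le

lemma arc_int {g : ℂ → ℂ} (hd : ∀ z : ℂ, 0 < z.im → DifferentiableAt ℂ g z)
    (hp : ∀ z : ℂ, 0 < z.im → g (z + 1) = g z) {a : ℝ} (ha : 0 < a) :
    lineInt g a = ∫ θ in (π/3)..(2*π/3), g (cexp (θ * I)) * (-I * cexp (θ * I)) := by
  have hs : 0 < √3 := by positivity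
  have hs2 : √3 ^ 2 = 3 := Real.sq_sqrt (by norm_num)
  rw [int_indep hd hp ha (by positivity : 0 < √3 / 2)]
  have hball : ∀ z ∈ Metric.ball (2 * I) 2, 0 < z.im := by
    intro z hz
    have h2 : |(z - 2 * I).im| < 2 := (Complex.abs_im_le_norm _).trans_lt (by simpa [dist_eq_norm] using hz)
    simp [abs_lt] at h2
    linarith [h2.1]
  have hmem : ∀ z : ℂ, z.re ^ 2 + (z.im - 2) ^ 2 < 4 → z ∈ Metric.ball (2 * I) 2 := by
    intro z hz
    rw [Metric.mem_ball, dist_eq_norm]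
    apply lt_of_pow_lt_pow_left₀ 2 (by norm_num)
    rw [Complex.sq_norm, Complex.normSq_apply]
    simp
    nlinarith
  obtain ⟨G, hG⟩ := DifferentiableOn.isExactOn_ball (f := g) (c := 2 * I) (r := 2)
    (fun z hz => (hd z (hball z hz)).differentiableWithinAt)
  have hper : Function.Periodic (fun x : ℝ => g (x + (√3/2 : ℝ) * I)) 1 := by
    intro x
    simp only
    rw [← hp (x + (√3/2 : ℝ) * I) (by simp)]
    congr 1; push_cast; ring
  have e1 : lineInt g (√3/2) = ∫ x in (-1/2 : ℝ)..(1/2), g (x + (√3/2 : ℝ) * I) := by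
    have := hper.intervalIntegral_add_eq 0 (-1/2)
    simp only [zero_add] at this
    rw [lineInt, this]; norm_num
  have e2 : ∫ x in (-1/2 : ℝ)..(1/2), g (x + (√3/2 : ℝ) * I) = G ((1/2 : ℝ) + (√3/2 : ℝ) * I) - G ((-1/2 : ℝ) + (√3/2 : ℝ) * I) := by
    apply intervalIntegral.integral_eq_sub_of_hasDerivAt (f := fun x : ℝ => G (x + (√3/2 : ℝ) * I))
    · intro x hx
      rw [Set.uIcc_of_le (by norm_num)] at hx
      have hm : (x + (√3/2 : ℝ) * I : ℂ) ∈ Metric.ball (2 * I) 2 := by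
        apply hmem
        simp
        nlinarith [hx.1, hx.2]
      have := HasDerivAt.comp_ofReal (e := fun x : ℂ => G (x + (√3/2 : ℝ) * I)) (z := x) (e' := g (x + (√3/2 : ℝ) * I))
        (by
          have := (hG _ hm).comp_add_const
          exact this)
      exact this
    · exact (lineInt_cont hd (by positivity)).intervalIntegrable _ _
  have hsin : ∀ θ ∈ Set.uIcc (π/3) (2*π/3), 1/2 < Real.sin θ := by
    intro θ hθ
    rw [Set.uIcc_of_le (by linarith [Real.pi_pos])] at hθ
    have h1 := Real.cos_lt_cos_of_nonneg_of_le_pi (x := |θ - π/2|) (y := π/3) (abs_nonneg _) (by linarith [Real.pi_pos])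
      (by rw [abs_lt]; constructor <;> linarith [Real.pi_pos, hθ.1, hθ.2])
    rw [Real.cos_abs, Real.cos_sub_pi_div_two, Real.cos_pi_div_three] at h1
    exact h1
  have hexp : ∀ θ : ℝ, (cexp (θ * I)) = ⟨Real.cos θ, Real.sin θ⟩ := by
    intro θ
    apply Complex.ext <;> simp [Complex.exp_ofReal_mul_I_re, Complex.exp_ofReal_mul_I_im]
  have e3 : ∫ θ in (π/3)..(2*π/3), g (cexp (θ * I)) * (I * cexp (θ * I)) = G (cexp ((2*π/3 : ℝ) * I)) - G (cexp ((π/3 : ℝ) * I)) := by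
    apply intervalIntegral.integral_eq_sub_of_hasDerivAt (f := fun x : ℝ => G (cexp (x * I)))
    · intro θ hθ
      have hm : (cexp (θ * I)) ∈ Metric.ball (2 * I) 2 := by
        apply hmem
        rw [hexp]
        simp only
        nlinarith [hsin θ hθ, Real.sin_sq_add_cos_sq θ]
      have h1 : HasDerivAt (fun x : ℂ => cexp (x * I)) (I * cexp (θ * I)) (θ : ℂ) := by
        have := ((hasDerivAt_id (θ : ℂ)).mul_const I).cexp
        simpa [mul_comm] using this
      exact ((hG _ hm).comp (θ : ℂ) h1).comp_ofReal
    · apply ContinuousOn.intervalIntegrable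
      intro θ hθ
      have h1 := (hd (cexp (θ * I)) (by rw [hexp]; simp only; linarith [hsin θ hθ])).continuousAt
      have h2 : ContinuousAt (fun θ : ℝ => g (cexp (θ * I))) θ :=
        ContinuousAt.comp (f := fun θ : ℝ => cexp (θ * I)) h1 (by fun_prop)
      exact (h2.mul (by fun_prop)).continuousWithinAt
  have p1 : cexp ((π/3 : ℝ) * I) = (1/2 : ℝ) + (√3/2 : ℝ) * I := by
    rw [hexp, Real.cos_pi_div_three, Real.sin_pi_div_three]
    apply Complex.ext <;> simp
  have p2 : cexp ((2*π/3 : ℝ) * I) = (-1/2 : ℝ) + (√3/2 : ℝ) * I := by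
    rw [hexp, show 2*π/3 = π - π/3 by ring, Real.cos_pi_sub, Real.sin_pi_sub, Real.cos_pi_div_three, Real.sin_pi_div_three]
    apply Complex.ext <;> simp
    norm_num
  rw [e1, e2, ← p1, ← p2]
  have : ∀ θ : ℝ, g (cexp (θ * I)) * (-I * cexp (θ * I)) = - (g (cexp (θ * I)) * (I * cexp (θ * I))) := fun θ => by ring
  simp_rw [this]
  rw [intervalIntegral.integral_neg, e3]; ring

lemma qexp_eq_qParam (z : ℂ) : qexp z = Function.Periodic.qParam 1 z := by
  simp [qexp, Function.Periodic.qParam]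

lemma qexp_ne (z : ℂ) : qexp z ≠ 0 := Complex.exp_ne_zero _

lemma qexp_lim : Tendsto qexp imTop (𝓝 0) := by
  have := (Function.Periodic.qParam_tendsto one_pos).mono_right nhdsWithin_le_nhds
  refine this.congr (fun z => (qexp_eq_qParam z).symm)

lemma qexp_per (z : ℂ) : qexp (z + 1) = qexp z := by
  simp [qexp, mul_add, Complex.exp_add]

lemma qexp_deriv (z : ℂ) : HasDerivAt qexp (2 * π * I * qexp z) z := by
  have := ((hasDerivAt_id z).const_mul (2 * π * I : ℂ)).cexp
  simp only [id, mul_one] at this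
  rw [mul_comm]; exact this

lemma qexp_norm (z : ℂ) : ‖qexp z‖ = Real.exp (-(2 * π * z.im)) := by
  rw [qexp, Complex.norm_exp]; congr 1; simp

lemma pow_tail {a : ℕ → ℂ} {g : ℂ → ℂ} (h : ∀ z : ℂ, 0 < z.im → HasSum (fun n => a n * qexp z ^ n) (g z))
    (N : ℕ) (ha : ∀ n < N, a n = 0) : Tendsto (fun z => g z / qexp z ^ N) imTop (𝓝 (a N)) := by
  have h1 : ∀ z : ℂ, 0 < z.im → HasSum (fun n => a (n + N) * qexp z ^ n) (g z / qexp z ^ N) := by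
    intro z hz
    have h2 := (hasSum_nat_add_iff' N).mpr (h z hz)
    rw [Finset.sum_eq_zero (fun i hi => by rw [ha i (Finset.mem_range.mp hi), zero_mul]), sub_zero] at h2
    refine (h2.div_const (qexp z ^ N)).congr_fun ?_
    intro n
    have := qexp_ne z
    field_simp
    ring
  have hs : Summable (fun n => ‖a (n + N) * qexp I ^ n‖) := (h1 I (by simp)).summable.norm
  have h3 : Tendsto (fun z => ∑' n, a (n + N) * qexp z ^ n) imTop (𝓝 (∑' n, a (n + N) * (0:ℂ) ^ n)) := by
    apply tendsto_tsum_of_dominated_convergence hs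
    · intro n
      exact (qexp_lim.pow n).const_mul _
    · filter_upwards [imTop_ev 1] with z hz n
      rw [norm_mul, norm_mul, norm_pow, norm_pow]
      gcongr
      rw [qexp_norm, qexp_norm]
      gcongr
      simpa using hz.le
  rw [tsum_eq_single 0 (by intro n hn; simp [hn])] at h3
  simp only [pow_zero, mul_one, zero_add] at h3
  refine h3.congr' ?_
  filter_upwards [imTop_ev 0] with z hz
  exact (h1 z hz).tsum_eq

lemma E2c_hasSum {z : ℂ} (hz : 0 < z.im) : HasSum (fun m : ℕ => (if m = 0 then 1 else -24 * (ArithmeticFunction.sigma 1 m) : ℂ) * qexp z ^ m) (E2c z) := by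
  have := EisensteinSeries.hasSum_qExpansion_E2 (z := ⟨z, hz⟩)
  rw [E2c, UpperHalfPlane.ofComplex_apply_of_im_pos hz]
  simpa [qexp] using this

lemma E2c_lim : Tendsto E2c imTop (𝓝 1) := by
  have := pow_tail (fun z hz => E2c_hasSum hz) 0 (by simp)
  simpa using this

lemma E2c_lim2 : Tendsto (fun z => (1 - E2c z) / qexp z) imTop (𝓝 24) := by
  have := pow_tail (g := fun z => E2c z - 1) (a := fun m => if m = 0 then 0 else -24 * (ArithmeticFunction.sigma 1 m : ℂ)) ?_ 1 (by simp)
  · have := this.neg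
    simp at this
    refine this.congr (fun z => by ring)
  · intro z hz
    have h2 := (E2c_hasSum hz)
    have h3 := (hasSum_nat_add_iff' 1).mpr h2
    rw [← hasSum_nat_add_iff' 1]
    simpa using h3

lemma tendsto_ofC {g : UpperHalfPlane → ℂ} {h : ℂ → ℂ} (hh : ∀ z : UpperHalfPlane, h z = g z) {L : ℂ}
    (hg : Tendsto g UpperHalfPlane.atImInfty (𝓝 L)) : Tendsto h imTop (𝓝 L) := by
  refine (hg.comp UpperHalfPlane.tendsto_comap_im_ofComplex).congr' ?_
  filter_upwards [imTop_ev 0] with z hz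
  simp [← hh, UpperHalfPlane.ofComplex_apply_of_im_pos hz]

lemma disc_lim : Tendsto (fun z => Disc z / qexp z) imTop (𝓝 1) := by
  apply tendsto_ofC _ ModularForm.tendsto_atImInfty_tprod_one_sub_eta_q_pow
  intro z
  rw [Disc, mul_div_cancel_left₀ _ (qexp_ne z)]
  simp [qexp, ModularForm.eta_q_eq_pow, Function.Periodic.qParam]

open UpperHalfPlane in
lemma eis_lim (k : ℕ) (hk : 3 ≤ k) (hk2 : Even k) : Tendsto (Eis k) imTop (𝓝 1) := by
  apply tendsto_ofC (eis_eq k hk)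
  have hper := SlashInvariantFormClass.periodic_comp_ofComplex (ModularForm.E hk) one_mem_strictPeriods_SL
  have hanal := ModularFormClass.analyticAt_cuspFunction_zero (ModularForm.E hk) one_pos one_mem_strictPeriods_SL
  have h0 := EisensteinSeries.E_qExpansion_coeff_zero hk hk2
  rw [qExpansion_coeff_zero one_pos hanal hper, ← cuspFunction_apply_zero one_pos hanal hper] at h0
  rw [← h0]
  exact (hanal.continuousAt.tendsto.comp (qParam_tendsto_atImInfty one_pos)).congr
    (fun τ ↦ SlashInvariantFormClass.eq_cuspFunction _ τ one_mem_strictPeriods_SL one_ne_zero)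

lemma jinv_diff {z : ℂ} (hz : 0 < z.im) : DifferentiableAt ℂ jinv z :=
  ((eis_diff 4 (by norm_num) hz).pow 3).div (disc_diff hz) (disc_ne hz)

lemma jinv_per {z : ℂ} (hz : 0 < z.im) : jinv (z + 1) = jinv z := by
  rw [jinv, jinv, eis_per 4 (by norm_num) hz, disc_per]

lemma jinv_S {z : ℂ} (hz : 0 < z.im) : jinv (-1 / z) = jinv z := by
  rw [jinv, jinv, eis_S 4 (by norm_num) hz, disc_S hz]
  have := im_ne hz
  have := disc_ne hz
  field_simp

lemma jq_lim : Tendsto (fun z => jinv z * qexp z) imTop (𝓝 1) := by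
  have := ((eis_lim 4 (by norm_num) (by decide)).pow 3).div disc_lim one_ne_zero
  simp only [one_pow, div_one] at this
  refine this.congr (fun z => ?_)
  simp only [Pi.div_apply, jinv]
  have := qexp_ne z
  field_simp

lemma jE2_lim : Tendsto (fun z => jinv z * (1 - E2c z)) imTop (𝓝 24) := by
  have := jq_lim.mul E2c_lim2
  rw [one_mul] at this
  refine this.congr (fun z => ?_)
  have := qexp_ne z
  field_simp

lemma qj_lim : Tendsto (fun z => qexp z * (deriv jinv z)) imTop (𝓝 (-2 * π * I)) := by
  have h1 : Tendsto (deriv (fun z => jinv z * qexp z)) imTop (𝓝 0) :=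
    deriv_tendsto (Y0 := 0) (fun z hz => (jinv_diff hz).mul (qexp_deriv z).differentiableAt) jq_lim
  have h2 := h1.sub (jq_lim.mul_const (2 * π * I))
  rw [show (0 : ℂ) - 1 * (2 * π * I) = -2 * π * I by ring] at h2
  refine h2.congr' ?_
  filter_upwards [imTop_ev 0] with z hz
  rw [show deriv (fun z => jinv z * qexp z) z = _ from ((jinv_diff hz).hasDerivAt.mul (qexp_deriv z)).deriv]
  ring

lemma dlogj_lim (x : ℂ) : Tendsto (fun z => deriv jinv z / (jinv z - x)) imTop (𝓝 (-2 * π * I)) := by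
  have h1 : Tendsto (fun z => jinv z * qexp z - x * qexp z) imTop (𝓝 (1 - x * 0)) :=
    jq_lim.sub (qexp_lim.const_mul x)
  have := qj_lim.div h1 (by simp)
  simp only [mul_zero, sub_zero, div_one] at this
  refine this.congr (fun z => ?_)
  simp only [Pi.div_apply, ← sub_mul]
  rw [mul_comm, mul_div_mul_right _ _ (qexp_ne z)]

lemma j_ne_ev (x : ℂ) : ∃ Y : ℝ, 0 < Y ∧ ∀ z : ℂ, Y < z.im → jinv z ≠ x := by
  have h1 : Tendsto (fun z => jinv z * qexp z - x * qexp z) imTop (𝓝 (1 - x * 0)) :=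
    jq_lim.sub (qexp_lim.const_mul x)
  have h2 := h1.eventually_ne (show (1 - x * 0 : ℂ) ≠ 0 by simp)
  rw [eventually_comap, eventually_atTop] at h2
  obtain ⟨Y, hY⟩ := h2
  refine ⟨max Y 1, by positivity, fun z hz h => hY z.im ((le_max_left _ _).trans hz.le) z rfl ?_⟩
  rw [h, sub_self]

open UpperHalfPlane in
def ramFun : ℍ → ℂ := Derivative.serreDerivative 6 (ModularForm.E (k := 6) (by norm_num)) +
  (1 / 2 : ℂ) • ((ModularForm.E (k := 4) (by norm_num) : ℍ → ℂ) * (ModularForm.E (k := 4) (by norm_num) : ℍ → ℂ))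

open UpperHalfPlane in
lemma ramFun_apply {z : ℂ} (hz : 0 < z.im) : ramFun ⟨z, hz⟩ = (2 * π * Complex.I)⁻¹ * deriv (Eis 6) z - 6 * 12⁻¹ * E2c z * Eis 6 z
    + 1 / 2 * (Eis 4 z * Eis 4 z) := by
  have h1 : deriv ((ModularForm.E (k := 6) (by norm_num) : ℍ → ℂ) ∘ ofComplex) z = deriv (Eis 6) z := by
    apply Filter.EventuallyEq.deriv_eq
    filter_upwards [UpperHalfPlane.isOpen_upperHalfPlaneSet.mem_nhds hz] with w hw
    exact eis_ofC 6 (by norm_num) hw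
  simp only [ramFun, Derivative.serreDerivative_eq, Derivative.normalizedDerivOfComplex, Pi.add_apply, Pi.smul_apply, Pi.mul_apply, smul_eq_mul]
  rw [h1, ← eis_eq, ← eis_eq, E2c, ofComplex_apply_of_im_pos hz]

open UpperHalfPlane in
lemma ramFun_slash (γ : Matrix.SpecialLinearGroup (Fin 2) ℤ) : SlashAction.map (8 : ℤ) γ ramFun = ramFun := by
  have h1 := Derivative.serreDerivative_slash_invariant (k := 6) (F := ModularForm.E (k := 6) (by norm_num)) 
    (ModularFormClass.holo _) (γ := γ) (SL_inv (ModularForm.E (k := 6) (by norm_num)) γ)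
  have h2 := ModularForm.mul_slash_SL2 4 4 γ (ModularForm.E (k := 4) (by norm_num)) (ModularForm.E (k := 4) (by norm_num))
  have h3 := SL_inv (ModularForm.E (k := 4) (by norm_num)) γ
  have h1 : SlashAction.map (8 : ℤ) γ (Derivative.serreDerivative 6 (ModularForm.E (k := 6) (by norm_num))) = Derivative.serreDerivative 6 (ModularForm.E (k := 6) (by norm_num)) := by
    exact_mod_cast h1
  norm_num at h2 h3
  rw [ramFun, SlashAction.add_slash, h1]
  rw [ModularForm.SL_smul_slash, h2, h3]

open UpperHalfPlane in
lemma ramFun_lim : Tendsto ramFun atImInfty (𝓝 0) := by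
  have h1 : Tendsto (fun z => (2 * π * Complex.I)⁻¹ * deriv (Eis 6) z - 6 * 12⁻¹ * E2c z * Eis 6 z
    + 1 / 2 * (Eis 4 z * Eis 4 z)) imTop (𝓝 ((2 * π * Complex.I)⁻¹ * 0 - 6 * 12⁻¹ * 1 * 1
    + 1 / 2 * (1 * 1))) := by
    have e6 := eis_lim 6 (by norm_num) (by decide)
    have e4 := eis_lim 4 (by norm_num) (by decide)
    have := deriv_tendsto (fun z hz => eis_diff 6 (by norm_num) hz) e6
    exact ((this.const_mul _).sub ((E2c_lim.const_mul _).mul e6)).add ((e4.mul e4).const_mul _)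
  have h2 := h1.comp tendsto_coe_atImInfty
  norm_num at h2
  refine h2.congr (fun z => ?_)
  have := ramFun_apply z.2
  simp only [Function.comp]
  rw [show ramFun z = _ from this]
  norm_num

open UpperHalfPlane ModularForm in
def ramCusp : CuspForm (Matrix.SpecialLinearGroup.mapGL (n := Fin 2) (R := ℤ) ℝ).range 8 where
  toFun := ramFun
  slash_action_eq' := by
    rintro _ ⟨γ, rfl⟩
    exact ramFun_slash γ
  holo' := by
    apply MDifferentiable.add
    · exact Derivative.serreDerivative_mdifferentiable _ (ModularFormClass.holo _)
    · exact ((ModularFormClass.holo _).mul (ModularFormClass.holo _)).const_smul _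
  zero_at_cusps' {c} hc := by
    rw [Subgroup.IsArithmetic.isCusp_iff_isCusp_SL2Z] at hc
    rw [OnePoint.isZeroAt_iff_forall_SL2Z hc]
    intro γ _
    rw [ramFun_slash]
    exact ramFun_lim

lemma ramanujan {z : ℂ} (hz : 0 < z.im) : HasDerivAt (Eis 6) (π * I * (E2c z * Eis 6 z - Eis 4 z ^ 2)) z := by
  have h := rank_zero_iff_forall_zero.mp (CuspForm.rank_eq_zero_of_weight_lt_twelve (k := 8) (by norm_num)) ramCusp
  have h2 : ramFun ⟨z, hz⟩ = 0 := DFunLike.congr_fun h ⟨z, hz⟩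
  rw [ramFun_apply] at h2
  have hpi : (π : ℂ) ≠ 0 := by exact_mod_cast Real.pi_ne_zero
  have hI := Complex.I_ne_zero
  have := (eis_diff 6 (by norm_num) hz).hasDerivAt
  refine this.congr_deriv ?_
  field_simp at h2
  linear_combination h2 / 12

lemma eis_conj (k : ℕ) (z : ℂ) : Eis k (-(starRingEnd ℂ) z) = (starRingEnd ℂ) (Eis k z) := by
  by_cases hk : k = 0
  · simp [Eis, hk]
  simp only [Eis, if_neg hk, map_mul]
  have h : (starRingEnd ℂ) (∑' p : ℤ × ℤ, if Int.gcd p.1 p.2 = 1 then 1 / ((p.1 : ℂ) * z + (p.2 : ℂ)) ^ k else 0)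
     = ∑' p : ℤ × ℤ, (starRingEnd ℂ) (if Int.gcd p.1 p.2 = 1 then 1 / ((p.1 : ℂ) * z + (p.2 : ℂ)) ^ k else 0) := tsum_star
  rw [h, ← ((Equiv.neg ℤ).prodCongr (Equiv.refl ℤ)).tsum_eq]
  congr 1
  · rw [map_div₀, map_one, Complex.conj_ofNat]
  apply tsum_congr
  rintro ⟨a, b⟩
  simp only [Equiv.prodCongr_apply, Prod.map, Equiv.neg_apply, Equiv.refl_apply, Int.neg_gcd]
  split_ifs <;> simp

lemma disc_conj {z : ℂ} (hz : 0 < z.im) : Disc (-(starRingEnd ℂ) z) = (starRingEnd ℂ) (Disc z) := by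
  have h1 := disc_eq_E hz
  have h2 := disc_eq_E (z := -(starRingEnd ℂ) z) (by simpa using hz)
  rw [eis_conj, eis_conj] at h2
  have h3 := congrArg (starRingEnd ℂ) h1
  simp only [map_mul, map_sub, map_pow] at h3
  rw [← h2] at h3
  have h5 : (starRingEnd ℂ) (1728:ℂ) = 1728 := by 
    rw [show (1728 : ℂ) = ((1728 : ℝ) : ℂ) by norm_num]; exact Complex.conj_ofReal _
  rw [h5] at h3
  exact (mul_left_cancel₀ (by norm_num) h3).symm

lemma arc_conj (θ : ℝ) : -(starRingEnd ℂ) (cexp (θ * I)) = -1 / cexp (θ * I) := by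
  rw [← Complex.exp_conj]; simp [Complex.exp_neg, neg_div]

lemma arc_im {θ : ℝ} (h0 : 0 < θ) (h1 : θ < π) : 0 < (cexp (θ * I)).im := by
  rw [Complex.exp_ofReal_mul_I_im]; exact Real.sin_pos_of_pos_of_lt_pi h0 h1

def aE4 (θ : ℝ) : ℝ := (cexp (θ * I) ^ 2 * Eis 4 (cexp (θ * I))).re
def aE6 (θ : ℝ) : ℝ := (cexp (θ * I) ^ 3 * Eis 6 (cexp (θ * I))).re
def aD (θ : ℝ) : ℝ := (cexp (θ * I) ^ 6 * Disc (cexp (θ * I))).re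
def aJ (θ : ℝ) : ℝ := (jinv (cexp (θ * I))).re

lemma conj_w_mul (θ : ℝ) : (starRingEnd ℂ) (cexp (θ * I)) * cexp (θ * I) = 1 := by
  rw [← Complex.exp_conj, ← Complex.exp_add]; simp

lemma real_of_arc {θ : ℝ} {v : ℂ} {k : ℕ} (h : (starRingEnd ℂ) v = cexp (θ * I) ^ (2 * k) * v) :
    (((cexp (θ * I) ^ k * v).re : ℝ) : ℂ) = cexp (θ * I) ^ k * v := by
  apply Complex.conj_eq_iff_re.mp
  rw [map_mul, h, map_pow]
  have := conj_w_mul θ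
  calc _ = ((starRingEnd ℂ) (cexp (θ * I)) * cexp (θ * I)) ^ k * cexp (θ * I) ^ k * v := by ring
    _ = _ := by rw [this]; ring

lemma aE4_eq {θ : ℝ} (h0 : 0 < θ) (h1 : θ < π) : (aE4 θ : ℂ) = cexp (θ * I) ^ 2 * Eis 4 (cexp (θ * I)) := by
  apply real_of_arc
  rw [← eis_conj, arc_conj, eis_S 4 (by norm_num) (arc_im h0 h1)]
lemma aE6_eq {θ : ℝ} (h0 : 0 < θ) (h1 : θ < π) : (aE6 θ : ℂ) = cexp (θ * I) ^ 3 * Eis 6 (cexp (θ * I)) := by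
  apply real_of_arc
  rw [← eis_conj, arc_conj, eis_S 6 (by norm_num) (arc_im h0 h1)]
lemma aD_eq {θ : ℝ} (h0 : 0 < θ) (h1 : θ < π) : (aD θ : ℂ) = cexp (θ * I) ^ 6 * Disc (cexp (θ * I)) := by
  apply real_of_arc
  rw [← disc_conj (arc_im h0 h1), arc_conj, disc_S (arc_im h0 h1)]
lemma aJ_eq {θ : ℝ} (h0 : 0 < θ) (h1 : θ < π) : (aJ θ : ℂ) = jinv (cexp (θ * I)) := by
  apply Complex.conj_eq_iff_re.mp
  have h := jinv_S (arc_im h0 h1)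
  rw [← arc_conj, jinv, eis_conj, disc_conj (arc_im h0 h1)] at h
  refine Eq.trans ?_ h
  simp [jinv]

lemma aD_ne {θ : ℝ} (h0 : 0 < θ) (h1 : θ < π) : aD θ ≠ 0 := by
  have := aD_eq h0 h1
  intro h
  rw [h] at this
  have h2 := mul_ne_zero (pow_ne_zero 6 (Complex.exp_ne_zero (θ * I))) (disc_ne (arc_im h0 h1))
  exact h2 (by rw [← this]; simp)

lemma a_rel {θ : ℝ} (h0 : 0 < θ) (h1 : θ < π) : 1728 * aD θ = aE4 θ ^ 3 - aE6 θ ^ 2 := by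
  have : ((1728 * aD θ : ℝ) : ℂ) = ((aE4 θ ^ 3 - aE6 θ ^ 2 : ℝ) : ℂ) := by
    push_cast
    rw [aD_eq h0 h1, aE4_eq h0 h1, aE6_eq h0 h1]
    linear_combination cexp (θ * I) ^ 6 * disc_eq_E (arc_im h0 h1)
  exact_mod_cast this

lemma aJ_val {θ : ℝ} (h0 : 0 < θ) (h1 : θ < π) : aJ θ = aE4 θ ^ 3 / aD θ := by
  have : ((aJ θ : ℝ) : ℂ) = ((aE4 θ ^ 3 / aD θ : ℝ) : ℂ) := by
    push_cast
    rw [aD_eq h0 h1, aE4_eq h0 h1, aJ_eq h0 h1, jinv]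
    have := Complex.exp_ne_zero (θ * I)
    have := disc_ne (arc_im h0 h1)
    field_simp
  exact_mod_cast this

lemma aJ_sub {θ : ℝ} (h0 : 0 < θ) (h1 : θ < π) : aJ θ - 1728 = aE6 θ ^ 2 / aD θ := by
  have := aD_ne h0 h1
  rw [aJ_val h0 h1]
  field_simp
  linarith [a_rel h0 h1]

lemma w_deriv (θ : ℝ) : HasDerivAt (fun t : ℝ => cexp (t * I)) (I * cexp (θ * I)) θ := by
  have := ((Complex.ofRealCLM.hasDerivAt (x := θ)).mul_const I).cexp
  simp only [Complex.ofRealCLM_apply, Complex.ofReal_one, one_mul] at this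
  rw [mul_comm]; exact this

def kap (θ : ℝ) : ℝ := (6 * I - 2 * π * cexp (θ * I) * E2c (cexp (θ * I))).re

lemma aD_deriv {θ : ℝ} (h0 : 0 < θ) (h1 : θ < π) : HasDerivAt aD (kap θ * aD θ) θ := by
  have h2 := ((w_deriv θ).pow 6).mul ((disc_deriv (arc_im h0 h1)).comp θ (w_deriv θ))
  have h3 := Complex.reCLM.hasFDerivAt.comp_hasDerivAt θ h2
  refine (show HasDerivAt aD _ θ from h3).congr_deriv ?_
  rw [kap, ← Complex.re_mul_ofReal, aD_eq h0 h1, Complex.reCLM_apply]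
  congr 1
  simp only [Function.comp, Pi.pow_apply]
  push_cast
  ring_nf
  simp only [I_sq]
  ring

lemma aE6_deriv {θ : ℝ} (h0 : 0 < θ) (h1 : θ < π) : HasDerivAt aE6 (kap θ * aE6 θ / 2 + π * aE4 θ ^ 2) θ := by
  have h2 := ((w_deriv θ).pow 3).mul ((ramanujan (arc_im h0 h1)).comp θ (w_deriv θ))
  have h3 := Complex.reCLM.hasFDerivAt.comp_hasDerivAt θ h2
  refine (show HasDerivAt aE6 _ θ from h3).congr_deriv ?_
  have h4 : kap θ * aE6 θ / 2 + π * aE4 θ ^ 2 = ((6 * I - 2 * π * cexp (θ * I) * E2c (cexp (θ * I))) * aE6 θ / 2 + π * aE4 θ ^ 2 : ℂ).re := by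
    rw [Complex.add_re, ← Complex.ofReal_pow, ← Complex.ofReal_mul, Complex.ofReal_re, kap, ← Complex.re_mul_ofReal]
    congr 1
    rw [show (2 : ℂ) = ((2 : ℝ) : ℂ) by norm_num, Complex.div_ofReal_re]
  rw [h4, aE4_eq h0 h1, aE6_eq h0 h1, Complex.reCLM_apply]
  congr 1
  simp only [Function.comp, Pi.pow_apply]
  push_cast
  ring_nf
  simp only [I_sq]
  ring

lemma w_half : cexp ((π / 2 : ℝ) * I) = I := by
  push_cast
  exact Complex.exp_pi_div_two_mul_I

lemma aE6_half : aE6 (π / 2) = 0 := by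
  have h := eis_S 6 (by norm_num) (z := I) (by simp)
  rw [show -1 / I = I by field_simp; simp, show I ^ 6 = -1 by rw [show I ^ 6 = (I ^ 2) ^ 3 by ring, I_sq]; norm_num] at h
  have h2 : Eis 6 I = 0 := by linear_combination h / 2
  rw [aE6, w_half, h2]; simp

open ComplexOrder in
lemma disc_I_nonneg : 0 ≤ Disc I := by
  have hq : qexp I = ((Real.exp (-(2 * π)) : ℝ) : ℂ) := by
    rw [qexp]; push_cast; congr 1; ring_nf; simp
  rw [Disc, hq]
  have hlt : Real.exp (-(2 * π)) ≤ 1 := Real.exp_le_one_iff.mpr (by linarith [Real.pi_pos])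
  apply mul_nonneg
  · exact_mod_cast (Real.exp_pos _).le
  · apply tprod_nonneg
    intro n
    apply pow_nonneg
    rw [← Complex.ofReal_pow]
    have := pow_le_one₀ (n := n + 1) (Real.exp_pos (-(2 * π))).le hlt
    rw [sub_nonneg]
    exact_mod_cast this

lemma aD_half : aD (π / 2) < 0 := by
  have h1 := aD_ne (θ := π / 2) (by positivity) (by linarith [Real.pi_pos])
  refine lt_of_le_of_ne ?_ h1
  rw [aD, w_half, show I ^ 6 = -1 by rw [show I ^ 6 = (I ^ 2) ^ 3 by ring, I_sq]; norm_num]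
  have := (Complex.le_def.mp disc_I_nonneg).1
  simpa using this

lemma aD_neg {θ : ℝ} (h0 : 0 < θ) (h1 : θ < π) : aD θ < 0 := by
  by_contra hcon
  have hc : ContinuousOn aD (Set.Ioo 0 π) := fun t ht => (aD_deriv ht.1 ht.2).continuousAt.continuousWithinAt
  have := isPreconnected_Ioo.intermediate_value (a := π / 2) (b := θ) ⟨by positivity, by linarith [Real.pi_pos]⟩ ⟨h0, h1⟩ hc
  obtain ⟨t, ht, ht2⟩ := this ⟨aD_half.le, not_lt.mp hcon⟩
  exact aD_ne ht.1 ht.2 ht2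

def aR (θ : ℝ) : ℝ := aE6 θ / √(-aD θ)

lemma aR_deriv {θ : ℝ} (h0 : 0 < θ) (h1 : θ < π) : HasDerivAt aR (π * aE4 θ ^ 2 / √(-aD θ)) θ := by
  have hn := aD_neg h0 h1
  have hs : 0 < √(-aD θ) := Real.sqrt_pos.mpr (by linarith)
  have h2 := (aE6_deriv h0 h1).div ((aD_deriv h0 h1).neg.sqrt (by simp; exact hn.ne)) hs.ne'
  refine h2.congr_deriv ?_
  have h3 : √(-aD θ) ^ 2 = - aD θ := Real.sq_sqrt (by linarith)
  simp only [Pi.neg_apply]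
  have h4 : aD θ = - √(-aD θ) ^ 2 := by linarith
  generalize √(-aD θ) = s at *
  rw [h4]
  field_simp
  ring

lemma aE6_ne {θ : ℝ} (h0 : 0 < θ) (h1 : θ < π) (hne : θ ≠ π / 2) : aE6 θ ≠ 0 := by
  have key : ∀ a b : ℝ, 0 < a → a < b → b < π → aE6 a = 0 → aE6 b = 0 → False := by
    intro a b ha hab hb h6a h6b
    have hd : ∀ t ∈ Set.Icc a b, HasDerivAt aR (π * aE4 t ^ 2 / √(-aD t)) t := fun t ht =>
      aR_deriv (ha.trans_le ht.1) (ht.2.trans_lt hb)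
    have hmono : MonotoneOn aR (Set.Icc a b) := by
      apply monotoneOn_of_deriv_nonneg (convex_Icc a b)
      · exact fun t ht => (hd t ht).continuousAt.continuousWithinAt
      · intro t ht
        rw [interior_Icc] at ht
        exact (hd t (Set.Ioo_subset_Icc_self ht)).differentiableAt.differentiableWithinAt
      · intro t ht
        rw [interior_Icc] at ht
        rw [(hd t (Set.Ioo_subset_Icc_self ht)).deriv]
        positivity
    have hz : ∀ t ∈ Set.Icc a b, aR t = 0 := by
      intro t ht
      have h3 := hmono (Set.left_mem_Icc.mpr hab.le) ht ht.1
      have h4 := hmono ht (Set.right_mem_Icc.mpr hab.le) ht.2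
      simp only [aR, h6a, h6b, zero_div] at h3 h4 ⊢
      exact le_antisymm h4 h3
    set t := (a + b) / 2 with ht
    have ht1 : t ∈ Set.Ioo a b := ⟨by linarith, by linarith⟩
    have ht0 : 0 < t := by linarith
    have htp : t < π := by linarith [ht1.2]
    have hs : 0 < √(-aD t) := Real.sqrt_pos.mpr (by linarith [aD_neg ht0 htp])
    have h5 : HasDerivAt aR 0 t := by
      refine (hasDerivAt_const t (0:ℝ)).congr_of_eventuallyEq ?_
      filter_upwards [isOpen_Ioo.mem_nhds ht1] with u hu
      exact hz u (Set.Ioo_subset_Icc_self hu)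
    have h6 := h5.unique (aR_deriv ht0 htp)
    have h7 : aE4 t = 0 := by
      have := (div_eq_zero_iff.mp h6.symm).resolve_right hs.ne'
      exact pow_eq_zero_iff (two_ne_zero) |>.mp ((mul_eq_zero.mp this).resolve_left Real.pi_ne_zero)
    have h8 : aE6 t = 0 := (div_eq_zero_iff.mp (hz t (Set.Ioo_subset_Icc_self ht1))).resolve_right hs.ne'
    have h9 := a_rel ht0 htp
    rw [h7, h8] at h9
    exact aD_ne ht0 htp (by linarith)
  intro h
  rcases lt_or_gt_of_ne hne with hlt | hgt
  · exact key _ _ h0 hlt (by linarith [Real.pi_pos]) h aE6_half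
  · exact key _ _ (by positivity) hgt h1 aE6_half h

lemma aJ_half : aJ (π / 2) = 1728 := by
  have := aJ_sub (θ := π / 2) (by positivity) (by linarith [Real.pi_pos])
  rw [aE6_half] at this
  simp at this
  linarith

lemma aJ_lt {θ : ℝ} (h0 : 0 < θ) (h1 : θ < π) (hne : θ ≠ π / 2) : aJ θ < 1728 := by
  have := aJ_sub h0 h1
  have h2 : aE6 θ ^ 2 / aD θ < 0 := div_neg_of_pos_of_neg (by have := aE6_ne h0 h1 hne; positivity) (aD_neg h0 h1)
  linarith

lemma aJ_cont {θ : ℝ} (h0 : 0 < θ) (h1 : θ < π) : ContinuousAt aJ θ := by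
  have h2 : ContinuousAt (fun t : ℝ => jinv (cexp (t * I))) θ :=
    ContinuousAt.comp (f := fun t : ℝ => cexp (t * I)) (jinv_diff (arc_im h0 h1)).continuousAt (w_deriv θ).continuousAt
  exact Complex.continuous_re.continuousAt.comp h2

lemma arc_mem {θ : ℝ} (h : θ ∈ Set.uIcc (π / 3) (2 * π / 3)) : 0 < θ ∧ θ < π := by
  have hp := Real.pi_pos
  rw [Set.uIcc_of_le (by linarith)] at h
  exact ⟨by linarith [h.1], by linarith [h.2]⟩

lemma w_comp_cont {g : ℂ → ℂ} (hd : ∀ z : ℂ, 0 < z.im → DifferentiableAt ℂ g z) :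
    ContinuousOn (fun t : ℝ => g (cexp (t * I))) (Set.uIcc (π / 3) (2 * π / 3)) := fun θ hθ =>
  (ContinuousAt.comp (f := fun t : ℝ => cexp (t * I)) (hd _ (arc_im (arc_mem hθ).1 (arc_mem hθ).2)).continuousAt
    (w_deriv θ).continuousAt).continuousWithinAt

lemma re_int {g : ℝ → ℂ} {h : ℝ → ℝ} (hc : ContinuousOn g (Set.uIcc (π / 3) (2 * π / 3)))
    (hh : ∀ θ ∈ Set.uIcc (π / 3) (2 * π / 3), h θ = (g θ).re) :
    (∫ θ in (π / 3)..(2 * π / 3), g θ).re = ∫ θ in (π / 3)..(2 * π / 3), h θ := by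
  have := Complex.reCLM.intervalIntegral_comp_comm (hc.intervalIntegrable (μ := volume))
  rw [Complex.reCLM_apply] at this
  rw [← this]
  apply intervalIntegral.integral_congr
  intro θ hθ
  rw [hh θ hθ]; rfl

lemma jpow_diff (B : ℝ) (n : ℕ) {z : ℂ} (hz : 0 < z.im) : DifferentiableAt ℂ (fun z => (jinv z + B) ^ n) z :=
  ((jinv_diff hz).add_const _).pow n

lemma jpow_val (B : ℝ) (n : ℕ) {θ : ℝ} (h : 0 < θ ∧ θ < π) : (jinv (cexp (θ * I)) + B) ^ n = (((aJ θ + B) ^ n : ℝ) : ℂ) := by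
  push_cast; rw [aJ_eq h.1 h.2]

lemma w_cont (s : Set ℝ) : ContinuousOn (fun t : ℝ => cexp (t * I)) s := fun θ _ => (w_deriv θ).continuousAt.continuousWithinAt

lemma ct1 (B : ℝ) (n : ℕ) : (lineInt (fun z => (jinv z + B) ^ n) 1).re =
    ∫ θ in (π / 3)..(2 * π / 3), (aJ θ + B) ^ n * Real.sin θ := by
  rw [arc_int (fun z hz => jpow_diff B n hz) (fun z hz => by simp only [jinv_per hz]) one_pos]
  apply re_int
  · exact (w_comp_cont (fun z hz => jpow_diff B n hz)).mul (continuousOn_const.mul (w_cont _))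
  · intro θ hθ
    rw [jpow_val B n (arc_mem hθ), Complex.re_ofReal_mul]
    simp [Complex.exp_ofReal_mul_I_im]

lemma w_pi_sub (θ : ℝ) : cexp ((π - θ : ℝ) * I) = -1 / cexp (θ * I) := by
  push_cast
  rw [sub_mul, Complex.exp_sub, Complex.exp_pi_mul_I]

lemma ct2 (B : ℝ) (n : ℕ) : (lineInt (fun z => (jinv z + B) ^ n * E2c z) 1).re =
    (3 / π) * ∫ θ in (π / 3)..(2 * π / 3), (aJ θ + B) ^ n := by
  have hpi : (π : ℂ) ≠ 0 := by exact_mod_cast Real.pi_ne_zero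
  have hd : ∀ z : ℂ, 0 < z.im → DifferentiableAt ℂ (fun z => (jinv z + B) ^ n * E2c z) z :=
    fun z hz => (jpow_diff B n hz).mul (E2c_diff hz)
  rw [arc_int hd (fun z hz => by simp only [jinv_per hz, E2c_per hz]) one_pos]
  set K : ℝ → ℂ := fun θ => (jinv (cexp (θ * I)) + B) ^ n * E2c (cexp (θ * I)) * (-I * cexp (θ * I)) with hK
  have hKc : ContinuousOn K (Set.uIcc (π / 3) (2 * π / 3)) :=
    (w_comp_cont hd).mul (continuousOn_const.mul (w_cont _))
  have hjc := w_comp_cont (fun z hz => jpow_diff B n hz)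
  have h1 : ∫ θ in (π / 3)..(2 * π / 3), K θ = ∫ θ in (π / 3)..(2 * π / 3), K (π - θ) := by
    rw [intervalIntegral.integral_comp_sub_left]
    congr 1 <;> ring
  have h2 : ∫ θ in (π / 3)..(2 * π / 3), K (π - θ) = ∫ θ in (π / 3)..(2 * π / 3), ((6 / π) * (jinv (cexp (θ * I)) + B) ^ n - K θ) := by
    apply intervalIntegral.integral_congr
    intro θ hθ
    have him := arc_im (arc_mem hθ).1 (arc_mem hθ).2
    simp only [hK]
    rw [w_pi_sub, jinv_S him, E2c_S him]
    have := Complex.exp_ne_zero (θ * I)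
    have hI := Complex.I_ne_zero
    field_simp
    ring
  have hjc2 : ContinuousOn (fun θ : ℝ => (6 / π : ℂ) * (jinv (cexp (θ * I)) + B) ^ n) (Set.uIcc (π / 3) (2 * π / 3)) :=
    continuousOn_const.mul hjc
  rw [intervalIntegral.integral_sub hjc2.intervalIntegrable hKc.intervalIntegrable,
    intervalIntegral.integral_const_mul] at h2
  rw [h2] at h1
  have h3 : ∫ θ in (π / 3)..(2 * π / 3), K θ = ((3 / π : ℝ) : ℂ) * ∫ θ in (π / 3)..(2 * π / 3), (jinv (cexp (θ * I)) + B) ^ n := by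
    push_cast
    linear_combination h1 / 2
  rw [h3, Complex.re_ofReal_mul]
  congr 1
  apply re_int hjc
  intro θ hθ
  rw [jpow_val B n (arc_mem hθ), Complex.ofReal_re]

lemma conc {c : ℝ} (hc : 3 / π < c) : ∃ (B : ℝ) (n : ℕ), 0 ≤ B ∧
    0 < ∫ θ in (π / 3)..(2 * π / 3), (aJ θ + B) ^ n * Real.sin θ ∧
    (3 / π) * (∫ θ in (π / 3)..(2 * π / 3), (aJ θ + B) ^ n) <
      c * ∫ θ in (π / 3)..(2 * π / 3), (aJ θ + B) ^ n * Real.sin θ := by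
  have hp := Real.pi_pos
  have hle : π / 3 ≤ 2 * π / 3 := by linarith
  have hc0 : 0 < c := lt_trans (by positivity) hc
  have hmem : ∀ θ ∈ Set.Icc (π / 3) (2 * π / 3), 0 < θ ∧ θ < π := fun θ h =>
    ⟨by linarith [h.1], by linarith [h.2]⟩
  have hcont : ContinuousOn aJ (Set.Icc (π / 3) (2 * π / 3)) := fun θ hθ =>
    (aJ_cont (hmem θ hθ).1 (hmem θ hθ).2).continuousWithinAt
  obtain ⟨M, hM⟩ := (isCompact_Icc.image_of_continuousOn hcont).bddBelow
  have hB : ∀ θ ∈ Set.Icc (π / 3) (2 * π / 3), 0 ≤ aJ θ + |M| := by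
    intro θ hθ
    have := hM ⟨θ, hθ, rfl⟩
    linarith [neg_abs_le M]
  have ht := tendsto_setIntegral_pow_smul_of_unique_maximum_of_isCompact_of_continuousOn (μ := volume)
    (x₀ := π / 2) (g := Real.sin)
    (isCompact_Icc (a := π / 3) (b := 2 * π / 3)) (c := fun θ => aJ θ + |M|) (hcont.add continuousOn_const)
    (by
      intro y hy hne
      have := aJ_lt (hmem y hy).1 (hmem y hy).2 hne
      simp only [aJ_half]; linarith)
    hB (by simp only [aJ_half]; positivity) 
    (by rw [interior_Icc]; apply subset_closure; constructor <;> linarith) Real.continuous_sin.continuousOn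
  rw [Real.sin_pi_div_two] at ht
  have h1 : 3 / π / c < 1 := by rw [div_lt_one hc0]; exact hc
  obtain ⟨n, hn⟩ := (ht.eventually (lt_mem_nhds h1)).exists
  refine ⟨|M|, n, abs_nonneg _, ?_⟩
  simp only [smul_eq_mul, integral_Icc_eq_integral_Ioc, ← intervalIntegral.integral_of_le hle] at hn
  set A := ∫ θ in (π / 3)..(2 * π / 3), (aJ θ + |M|) ^ n with hA
  set S := ∫ θ in (π / 3)..(2 * π / 3), (aJ θ + |M|) ^ n * Real.sin θ with hS
  have hA0 : 0 ≤ A := intervalIntegral.integral_nonneg hle (fun θ hθ => pow_nonneg (hB θ hθ) n)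
  have hA1 : A ≠ 0 := by
    intro h
    rw [h] at hn
    have : 0 < 3 / π / c := by positivity
    simp at hn; linarith
  have hA2 : 0 < A := lt_of_le_of_ne hA0 hA1.symm
  have h3 : 3 / π * A < c * S := by
    rw [inv_mul_eq_div, lt_div_iff₀ hA2, div_mul_eq_mul_div, div_lt_iff₀ hc0] at hn
    linarith
  refine ⟨?_, h3⟩
  have : 0 < c * S := lt_trans (by positivity) h3
  exact (mul_pos_iff_of_pos_left hc0).mp this

def Good (Y0 : ℝ) (g : ℂ → ℂ) : Prop :=
  (∀ z : ℂ, Y0 < z.im → DifferentiableAt ℂ g z) ∧ (∀ z : ℂ, Y0 < z.im → g (z + 1) = g z)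

lemma Good.mono {Y0 Y1 : ℝ} {g : ℂ → ℂ} (h : Good Y0 g) (hY : Y0 ≤ Y1) : Good Y1 g :=
  ⟨fun z hz => h.1 z (hY.trans_lt hz), fun z hz => h.2 z (hY.trans_lt hz)⟩

lemma Good.const (Y0 : ℝ) (a : ℂ) : Good Y0 (fun _ => a) := ⟨fun _ _ => by fun_prop, fun _ _ => rfl⟩

lemma Good.add {Y0 : ℝ} {g h : ℂ → ℂ} (hg : Good Y0 g) (hh : Good Y0 h) : Good Y0 (fun z => g z + h z) :=
  ⟨fun z hz => (hg.1 z hz).add (hh.1 z hz), fun z hz => by simp only [hg.2 z hz, hh.2 z hz]⟩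

lemma Good.sub {Y0 : ℝ} {g h : ℂ → ℂ} (hg : Good Y0 g) (hh : Good Y0 h) : Good Y0 (fun z => g z - h z) :=
  ⟨fun z hz => (hg.1 z hz).sub (hh.1 z hz), fun z hz => by simp only [hg.2 z hz, hh.2 z hz]⟩

lemma Good.mul {Y0 : ℝ} {g h : ℂ → ℂ} (hg : Good Y0 g) (hh : Good Y0 h) : Good Y0 (fun z => g z * h z) :=
  ⟨fun z hz => (hg.1 z hz).mul (hh.1 z hz), fun z hz => by simp only [hg.2 z hz, hh.2 z hz]⟩

lemma Good.pow {Y0 : ℝ} {g : ℂ → ℂ} (hg : Good Y0 g) (n : ℕ) : Good Y0 (fun z => g z ^ n) :=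
  ⟨fun z hz => (hg.1 z hz).pow n, fun z hz => by simp only [hg.2 z hz]⟩

lemma Good.div {Y0 : ℝ} {g h : ℂ → ℂ} (hg : Good Y0 g) (hh : Good Y0 h) (h0 : ∀ z : ℂ, Y0 < z.im → h z ≠ 0) :
    Good Y0 (fun z => g z / h z) :=
  ⟨fun z hz => (hg.1 z hz).div (hh.1 z hz) (h0 z hz), fun z hz => by simp only [hg.2 z hz, hh.2 z hz]⟩

lemma Good.poly {Y0 : ℝ} {g : ℂ → ℂ} (hg : Good Y0 g) (P : ℂ[X]) : Good Y0 (fun z => P.eval (g z)) :=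
  ⟨fun z hz => (P.differentiableAt).comp z (hg.1 z hz), fun z hz => by simp only [hg.2 z hz]⟩

lemma halfplane_open (Y0 : ℝ) : IsOpen {z : ℂ | Y0 < z.im} := isOpen_lt continuous_const Complex.continuous_im

lemma Good.deriv {Y0 : ℝ} {g : ℂ → ℂ} (hg : Good Y0 g) : Good Y0 (deriv g) := by
  refine ⟨fun z hz => ?_, fun z hz => ?_⟩
  · have : DifferentiableOn ℂ g {z : ℂ | Y0 < z.im} := fun w hw => (hg.1 w hw).differentiableWithinAt
    exact ((this.deriv (halfplane_open Y0)) z hz).differentiableAt ((halfplane_open Y0).mem_nhds hz)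
  · rw [← deriv_comp_add_const]
    apply Filter.EventuallyEq.deriv_eq
    filter_upwards [(halfplane_open Y0).mem_nhds hz] with w hw
    exact hg.2 w hw

lemma Good.cont {Y0 : ℝ} {g : ℂ → ℂ} (hg : Good Y0 g) {Y : ℝ} (hY : Y0 < Y) :
    Continuous (fun x : ℝ => g (x + Y * I)) := lineInt_cont hg.1 hY

lemma lineInt_congr {g h : ℂ → ℂ} {Y : ℝ} (H : ∀ z : ℂ, z.im = Y → g z = h z) : lineInt g Y = lineInt h Y := by
  unfold lineInt
  congr 1; ext x
  exact H _ (by simp)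

lemma lineInt_add {Y0 : ℝ} {g h : ℂ → ℂ} (hg : Good Y0 g) (hh : Good Y0 h) {Y : ℝ} (hY : Y0 < Y) :
    lineInt (fun z => g z + h z) Y = lineInt g Y + lineInt h Y :=
  intervalIntegral.integral_add ((hg.cont hY).intervalIntegrable _ _) ((hh.cont hY).intervalIntegrable _ _)

lemma lineInt_sub {Y0 : ℝ} {g h : ℂ → ℂ} (hg : Good Y0 g) (hh : Good Y0 h) {Y : ℝ} (hY : Y0 < Y) :
    lineInt (fun z => g z - h z) Y = lineInt g Y - lineInt h Y :=
  intervalIntegral.integral_sub ((hg.cont hY).intervalIntegrable _ _) ((hh.cont hY).intervalIntegrable _ _)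

lemma lineInt_smul (a : ℂ) (g : ℂ → ℂ) (Y : ℝ) :
    lineInt (fun z => a * g z) Y = a * lineInt g Y :=
  intervalIntegral.integral_const_mul _ _

lemma lineInt_deriv {Y0 : ℝ} {g : ℂ → ℂ} (hg : Good Y0 g) {Y : ℝ} (hY : Y0 < Y) : lineInt (deriv g) Y = 0 := by
  have : lineInt (_root_.deriv g) Y = g ((1:ℝ) + Y * I) - g ((0:ℝ) + Y * I) := by
    apply intervalIntegral.integral_eq_sub_of_hasDerivAt (f := fun x : ℝ => g (x + Y * I))
    · intro x _
      have h1 := (hg.1 (x + Y * I) (by simpa using hY)).hasDerivAt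
      have h2 : HasDerivAt (fun x : ℝ => (x + Y * I : ℂ)) 1 x := by
        simpa using (Complex.ofRealCLM.hasDerivAt (x := x)).add_const (Y * I : ℂ)
      have h3 := h1.comp x h2
      rw [mul_one] at h3
      exact h3
    · exact (hg.deriv.cont hY).intervalIntegrable _ _
  rw [this, sub_eq_zero, ← hg.2 ((0:ℝ) + Y * I) (by simpa using hY)]
  congr 1; simp; ring

lemma good_j : Good 0 jinv := ⟨fun _ hz => jinv_diff hz, fun _ hz => jinv_per hz⟩
lemma good_E2 : Good 0 E2c := ⟨fun _ hz => E2c_diff hz, fun _ hz => E2c_per hz⟩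
lemma good_q : Good 0 qexp := ⟨fun z _ => (qexp_deriv z).differentiableAt, fun z _ => qexp_per z⟩

lemma lineInt_Qj (Q : ℂ[X]) {Y : ℝ} (hY : 0 < Y) : lineInt (fun z => Q.eval (jinv z) * deriv jinv z) Y = 0 := by
  induction Q using Polynomial.induction_on' with
  | add p q hp hq =>
    rw [← add_zero (0:ℂ)]
    nth_rw 1 [← hp]
    rw [← hq, ← lineInt_add ((good_j.poly p).mul good_j.deriv) ((good_j.poly q).mul good_j.deriv) hY]
    exact lineInt_congr (fun z _ => by simp; ring)
  | monomial n a =>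
    have h := lineInt_deriv (good_j.pow (n+1)) hY
    have h2 := lineInt_smul (a / (n+1)) (deriv (fun z => jinv z ^ (n+1))) Y
    rw [h, mul_zero] at h2
    rw [← h2]
    refine lineInt_congr (fun z hz => ?_)
    have hd : HasDerivAt (fun z => jinv z ^ (n+1)) _ z := (jinv_diff (hz ▸ hY)).hasDerivAt.pow (n+1)
    rw [hd.deriv]
    have : (n + 1 : ℂ) ≠ 0 := by exact_mod_cast n.succ_ne_zero
    simp
    field_simp

lemma lineInt_root (P : ℂ[X]) (x : ℂ) {Y : ℝ} (hY : 0 < Y) (hx : ∀ z : ℂ, Y ≤ z.im → jinv z ≠ x) {Y' : ℝ} (hY' : Y < Y') :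
    Good Y (fun z => P.eval (jinv z) * (deriv jinv z / (jinv z - x))) ∧
    lineInt (fun z => P.eval (jinv z) * (deriv jinv z / (jinv z - x))) Y' = -2 * π * I * P.eval x := by
  have gj := good_j.mono hY.le
  have g1 : Good Y (fun z => deriv jinv z / (jinv z - x)) :=
    gj.deriv.div (gj.sub (Good.const Y x)) (fun z hz => sub_ne_zero.mpr (hx z hz.le))
  refine ⟨(gj.poly P).mul g1, ?_⟩
  have e := modByMonic_add_div P (X - C x)
  rw [modByMonic_X_sub_C_eq_C_eval] at e
  set Q := P /ₘ (X - C x)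
  have e2 : lineInt (fun z => P.eval (jinv z) * (deriv jinv z / (jinv z - x))) Y' =
      lineInt (fun z => P.eval x * (deriv jinv z / (jinv z - x)) + Q.eval (jinv z) * deriv jinv z) Y' := by
    refine lineInt_congr (fun z hz => ?_)
    have h0 := sub_ne_zero.mpr (hx z (hz ▸ hY'.le))
    have : P.eval (jinv z) = P.eval x + (jinv z - x) * Q.eval (jinv z) := by
      conv_lhs => rw [← e]
      simp
    rw [this]
    field_simp
  rw [e2, lineInt_add ((Good.const Y _).mul g1) ((gj.poly Q).mul gj.deriv) hY', lineInt_smul,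
    lineInt_Qj Q (hY.trans hY'), int_lim g1.1 g1.2 (dlogj_lim x) hY']
  ring

lemma lineInt_roots (P : ℂ[X]) (s : Multiset ℂ) : ∃ Y : ℝ, 0 < Y ∧ (∀ x ∈ s, ∀ z : ℂ, Y ≤ z.im → jinv z ≠ x) ∧
    Good Y (fun z => (s.map (fun x => P.eval (jinv z) * (deriv jinv z / (jinv z - x)))).sum) ∧ ∀ Y', Y < Y' →
    lineInt (fun z => (s.map (fun x => P.eval (jinv z) * (deriv jinv z / (jinv z - x)))).sum) Y' =
      -2 * π * I * (s.map (fun x => P.eval x)).sum := by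
  induction s using Multiset.induction_on with
  | empty =>
    refine ⟨1, one_pos, by simp, by simpa using Good.const 1 0, by simp [lineInt]⟩
  | cons a s ih =>
    obtain ⟨Y1, hY1, h1, h2, h3⟩ := ih
    obtain ⟨Y2, hY2, h4⟩ := j_ne_ev a
    have hY : 0 < max Y1 (Y2 + 1) := lt_max_of_lt_left hY1
    have hr : ∀ z : ℂ, max Y1 (Y2 + 1) ≤ z.im → jinv z ≠ a :=
      fun z hz => h4 z (by linarith [le_max_right Y1 (Y2+1)])
    have G1 := (lineInt_root P a hY hr (lt_add_one _)).1
    have G2 := h2.mono (le_max_left Y1 (Y2+1))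
    refine ⟨max Y1 (Y2+1), hY, ?_, ?_, fun Y' hY' => ?_⟩
    · intro x hx z hz
      rcases Multiset.mem_cons.mp hx with rfl | hx
      · exact hr z hz
      · exact h1 x hx z ((le_max_left _ _).trans hz)
    · simp only [Multiset.map_cons, Multiset.sum_cons]
      exact G1.add G2
    · simp only [Multiset.map_cons, Multiset.sum_cons]
      rw [lineInt_add G1 G2 hY', (lineInt_root P a hY hr hY').2, h3 Y' ((le_max_left _ _).trans_lt hY')]
      ring

lemma eis_all {k' : ℕ} (hk' : k' = 0 ∨ k' = 4 ∨ k' = 6 ∨ k' = 8 ∨ k' = 10 ∨ k' = 14) :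
    Good 0 (Eis k') ∧ ∃ Y : ℝ, 0 < Y ∧ ∀ z : ℂ, Y < z.im → Eis k' z ≠ 0 := by
  have h : Good 0 (Eis k') ∧ Tendsto (Eis k') imTop (𝓝 1) := by
    by_cases h0 : k' = 0
    · have : Eis k' = fun _ => 1 := by ext z; simp [Eis, h0]
      rw [this]
      exact ⟨Good.const 0 1, tendsto_const_nhds⟩
    · have h3 : 3 ≤ k' := by omega
      have he : Even k' := by rw [Nat.even_iff]; omega
      exact ⟨⟨fun _ hz => eis_diff k' h3 hz, fun _ hz => eis_per k' h3 hz⟩, eis_lim k' h3 he⟩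
  refine ⟨h.1, ?_⟩
  have h2 := h.2.eventually_ne (one_ne_zero)
  rw [eventually_comap, eventually_atTop] at h2
  obtain ⟨Y, hY⟩ := h2
  exact ⟨max Y 1, by positivity, fun z hz => hY z.im ((le_max_left _ _).trans hz.le) z rfl⟩

lemma Pj_q (P : ℂ[X]) {D : ℕ} (hD : P.natDegree ≤ D) :
    ∃ L, Tendsto (fun z => P.eval (jinv z) * qexp z ^ D) imTop (𝓝 L) := by
  have h1 : ∀ i ∈ Finset.range (D + 1), Tendsto (fun z => P.coeff i * ((jinv z * qexp z) ^ i * qexp z ^ (D - i))) imTop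
      (𝓝 (P.coeff i * (1 ^ i * 0 ^ (D - i)))) := fun i _ =>
    ((jq_lim.pow i).mul (qexp_lim.pow (D - i))).const_mul _
  refine ⟨_, (tendsto_finsetSum _ h1).congr (fun z => ?_)⟩
  rw [eval_eq_sum_range' (Nat.lt_succ_of_le hD), Finset.sum_mul]
  refine Finset.sum_congr rfl (fun i hi => ?_)
  have hi : i ≤ D := Nat.lt_succ_iff.mp (Finset.mem_range.mp hi)
  obtain ⟨d, rfl⟩ := Nat.exists_eq_add_of_le hi
  simp only [Nat.add_sub_cancel_left, mul_pow, pow_add]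
  ring

lemma W_lim (P : ℂ[X]) {ℓ k' m : ℕ} {f : ℂ → ℂ} (hm : m < ℓ) (hf : IsMillerForm ℓ k' m f)
    (hP : P.natDegree ≤ ℓ - m) :
    Tendsto (fun z => P.eval (jinv z) * (deriv f z / f z - 2 * π * I * m)) imTop (𝓝 0) := by
  obtain ⟨fd, fp, -, a, ha, hd⟩ := hf
  obtain ⟨D, rfl⟩ := Nat.exists_eq_add_of_lt hm
  obtain ⟨E, hE⟩ : ∃ E, E = D + 1 := ⟨_, rfl⟩
  rw [show m + D + 1 - m = E by omega] at hP
  rw [show m + D + 1 = m + E by omega] at hd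
  obtain ⟨L, hL⟩ := Pj_q P hP
  have gf : Good 0 f := ⟨fd, fp⟩
  have gv : Good 0 (fun z => (f z - qexp z ^ m) / qexp z ^ (m + E)) :=
    (gf.sub (good_q.pow m)).div (good_q.pow (m + E)) (fun z _ => pow_ne_zero _ (qexp_ne z))
  have hv : Tendsto (fun z => (f z - qexp z ^ m) / qexp z ^ (m + E)) imTop (𝓝 0) := by
    have := pow_tail (a := fun n => a n - if n = m then 1 else 0) (g := fun z => f z - qexp z ^ m) ?_ (m + E) ?_
    · simp only [hd (m + E) le_rfl, sub_self] at this
      exact this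
    · intro z hz
      have h1 : HasSum (fun n => a n * qexp z ^ n) (f z) := by
        rw [(ha z hz).2]; exact (ha z hz).1.hasSum
      have h2 : HasSum (fun n => (if n = m then (1:ℂ) else 0) * qexp z ^ n) (qexp z ^ m) := by
        have := hasSum_ite_eq m (qexp z ^ m)
        refine this.congr_fun ?_
        intro n
        by_cases h : n = m <;> simp [h]
      refine (h1.sub h2).congr_fun (fun n => ?_)
      ring
    · intro n hn
      simp [hd n hn.le]
  set v := (fun z => (f z - qexp z ^ m) / qexp z ^ (m + E)) with hvdef
  have hv' := deriv_tendsto gv.1 hv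
  have hf1 : ∀ z, f z = qexp z ^ m + qexp z ^ (m + E) * v z := by
    intro z
    simp only [hvdef]
    have := qexp_ne z
    field_simp
    ring
  have hden : Tendsto (fun z => 1 + qexp z ^ E * v z) imTop (𝓝 (1 + 0 ^ E * 0)) :=
    ((qexp_lim.pow E).mul hv).const_add 1
  have hnum := hL.mul ((hv.const_mul (2 * π * I * E)).add hv')
  have := hnum.div hden (by simp)
  simp only [mul_zero, add_zero, div_one] at this
  refine this.congr' ?_
  filter_upwards [imTop_ev 0, hden.eventually_ne (show (1 + 0 ^ E * 0 : ℂ) ≠ 0 by simp)] with z hz hz1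
  have hfd : HasDerivAt f (m * qexp z ^ (m - 1) * (2 * π * I * qexp z) +
      (((m + E : ℕ) : ℂ) * qexp z ^ (m + E - 1) * (2 * π * I * qexp z) * v z + qexp z ^ (m + E) * deriv v z)) z := by
    have h1 := ((qexp_deriv z).pow m).add (((qexp_deriv z).pow (m + E)).mul (gv.1 z hz).hasDerivAt)
    have h2 : f = fun z => qexp z ^ m + qexp z ^ (m + E) * v z := funext hf1
    rw [h2]
    exact h1
  have e1 : (m : ℂ) * qexp z ^ (m - 1) * (2 * π * I * qexp z) = 2 * π * I * m * qexp z ^ m := by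
    rcases m with _ | m
    · simp
    · simp [pow_succ]; ring
  have e2 : ((m + E : ℕ) : ℂ) * qexp z ^ (m + E - 1) * (2 * π * I * qexp z) = 2 * π * I * (m + E) * qexp z ^ (m + E) := by
    rw [show m + E = (m + D) + 1 by omega]
    simp [pow_succ, hE]; ring
  rw [e1, e2] at hfd
  rw [hfd.deriv, pow_add]
  have e3 : f z = qexp z ^ m * (1 + qexp z ^ E * v z) := by rw [hf1]; ring
  rw [e3]
  have hq := pow_ne_zero m (qexp_ne z)
  simp only [Pi.div_apply]
  clear hfd e1 e2 e3
  generalize v z = V at *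
  generalize deriv v z = V' at *
  generalize qexp z ^ E = Q at *
  generalize qexp z ^ m = q at *
  field_simp
  ring

lemma logderiv_f {ℓ k' m : ℕ} {f : ℂ → ℂ} {F : ℂ[X]} (hF : IsFaber ℓ k' m f F) (gE : Good 0 (Eis k')) {z : ℂ}
    (hz : 0 < z.im) (hE : Eis k' z ≠ 0) (hj : ∀ x ∈ F.roots, jinv z ≠ x) :
    deriv f z / f z = 2 * π * I * ℓ * E2c z + deriv (Eis k') z / Eis k' z +
      (F.roots.map (fun x => deriv jinv z / (jinv z - x))).sum := by
  obtain ⟨hm, -, hf⟩ := hF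
  have hFj : F.eval (jinv z) ≠ 0 := fun h => hj _ ((mem_roots hm.ne_zero).mpr h) rfl
  have h1 := (IsAlgClosed.splits F).eval_derivative_div_eval_of_ne_zero hFj
  have h2 : (F.roots.map (fun x => deriv jinv z / (jinv z - x))).sum = deriv jinv z * (F.derivative.eval (jinv z) / F.eval (jinv z)) := by
    rw [h1, ← Multiset.sum_map_mul_left]
    simp only [mul_one_div]
  have hfd : HasDerivAt f _ z := ((((disc_deriv hz).pow ℓ).mul (gE.1 z hz).hasDerivAt).mul
    ((F.hasDerivAt (jinv z)).comp z (jinv_diff hz).hasDerivAt)).congr_of_eventuallyEq (by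
      filter_upwards [(halfplane_open 0).mem_nhds hz] with w hw
      exact hf w hw)
  rw [hfd.deriv, hf z hz, h2]
  have hD := disc_ne hz
  simp only [Pi.mul_apply, Pi.pow_apply, Function.comp]
  have e1 : (ℓ : ℂ) * Disc z ^ (ℓ - 1) * (2 * π * I * E2c z * Disc z) = 2 * π * I * ℓ * E2c z * Disc z ^ ℓ := by
    rcases ℓ with _ | l
    · simp
    · simp [pow_succ]; ring
  rw [e1]
  have := pow_ne_zero ℓ hD
  field_simp

lemma root_sum {k' : ℕ} (hk' : k' = 0 ∨ k' = 4 ∨ k' = 6 ∨ k' = 8 ∨ k' = 10 ∨ k' = 14) (P : ℂ[X]) :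
    ∃ γ : ℂ, ∀ (ℓ m : ℕ) (f : ℂ → ℂ) (F : ℂ[X]), m < ℓ → IsMillerForm ℓ k' m f → IsFaber ℓ k' m f F →
      P.natDegree ≤ ℓ - m →
      (F.roots.map (fun x => P.eval x)).sum = ℓ * lineInt (fun z => P.eval (jinv z) * E2c z) 1 -
        m * lineInt (fun z => P.eval (jinv z)) 1 + γ := by
  obtain ⟨gE, Y1, hY1, hE⟩ := eis_all hk'
  refine ⟨(2 * π * I)⁻¹ * lineInt (fun z => P.eval (jinv z) * (deriv (Eis k') z / Eis k' z)) (Y1 + 1), ?_⟩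
  intro ℓ m f F hm hf hF hP
  obtain ⟨Y2, hY2, h1, h2, h3⟩ := lineInt_roots P F.roots
  have hl1 : Y1 ≤ max Y1 Y2 := le_max_left _ _
  have hl2 : Y2 ≤ max Y1 Y2 := le_max_right _ _
  generalize max Y1 Y2 = M at hl1 hl2
  have hM : 0 < M := by linarith
  have gP := (good_j.poly P)
  have gA : Good 0 (fun z => P.eval (jinv z) * E2c z) := gP.mul good_E2
  have gB : Good Y1 (fun z => P.eval (jinv z) * (deriv (Eis k') z / Eis k' z)) :=
    (gP.mono hY1.le).mul ((gE.mono hY1.le).deriv.div (gE.mono hY1.le) hE)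
  have e : ∀ z : ℂ, M < z.im → P.eval (jinv z) * (deriv f z / f z - 2 * π * I * m) =
      ((2 * π * I * ℓ * (P.eval (jinv z) * E2c z) + P.eval (jinv z) * (deriv (Eis k') z / Eis k' z)) +
      (F.roots.map (fun x => P.eval (jinv z) * (deriv jinv z / (jinv z - x)))).sum) - 2 * π * I * m * P.eval (jinv z) := by
    intro z hz
    rw [logderiv_f hF gE (hM.trans hz) (hE z (by linarith)) (fun x hx => h1 x hx z (by linarith)),
      Multiset.sum_map_mul_left]
    ring
  have g1 := ((Good.const M (2 * π * I * ℓ)).mul (gA.mono hM.le))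
  have g2 := g1.add (gB.mono hl1)
  have g3 := g2.add (h2.mono hl2)
  have g4 := (Good.const M (2 * π * I * m)).mul (gP.mono hM.le)
  have g5 := g3.sub g4
  have hlim := (W_lim P hm hf hP).congr' (show _ =ᶠ[imTop] fun z =>
      ((2 * π * I * ℓ * (P.eval (jinv z) * E2c z) + P.eval (jinv z) * (deriv (Eis k') z / Eis k' z)) +
      (F.roots.map (fun x => P.eval (jinv z) * (deriv jinv z / (jinv z - x)))).sum) - 2 * π * I * m * P.eval (jinv z) by
    filter_upwards [imTop_ev M] with z hz
    exact e z hz)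
  have hM1 : M < M + 1 := lt_add_one M
  have h0 := int_lim g5.1 g5.2 hlim hM1
  rw [lineInt_sub g3 g4 hM1, lineInt_add g2 (h2.mono hl2) hM1, lineInt_add g1 (gB.mono hl1) hM1, lineInt_smul, lineInt_smul,
    h3 _ (by linarith), int_indep gA.1 gA.2 (by linarith : 0 < M + 1) one_pos,
    int_indep gP.1 gP.2 (by linarith : 0 < M + 1) one_pos,
    int_indep gB.1 gB.2 (by linarith : Y1 < M + 1) (lt_add_one Y1)] at h0
  have hpi : (2 * π * I : ℂ) ≠ 0 := Complex.two_pi_I_ne_zero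
  apply mul_left_cancel₀ hpi
  rw [mul_add, mul_inv_cancel_left₀ hpi]
  linear_combination -h0

lemma re_sum_nonneg (s : Multiset ℂ) (P : ℂ[X]) (h : ∀ x ∈ s, 0 ≤ (P.eval x).re) :
    0 ≤ ((s.map (fun x => P.eval x)).sum).re := by
  induction s using Multiset.induction_on with
  | empty => simp
  | cons a s ih =>
    simp only [Multiset.map_cons, Multiset.sum_cons, Complex.add_re]
    exact add_nonneg (h a (Multiset.mem_cons_self a s)) (ih (fun x hx => h x (Multiset.mem_cons_of_mem hx)))

lemma lineInt_jE2 : lineInt (fun z => jinv z * E2c z) 1 = lineInt jinv 1 - 24 := by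
  have g : Good 0 (fun z => jinv z * (1 - E2c z)) := good_j.mul ((Good.const 0 1).sub good_E2)
  have h := int_lim g.1 g.2 jE2_lim one_pos
  rw [← h, ← lineInt_sub good_j g one_pos]
  exact lineInt_congr (fun z _ => by ring)

/-- Let `3/π < c < 1` and fix `k' ∈ {0,4,6,8,10,14}`.  There is
`L = L(c,k')` such that for all `ℓ > L` and all `m` with `cℓ < m ≤ ℓ - 1`, at least
one zero of the Miller basis form `f_{12ℓ+k', m}` is not on the arc, i.e. at least
one zero of its Faber polynomial lies outside `[0,1728]`. -/
theorem zero_off_arc_above_three_over_pi (c : ℝ) (hc1 : 3 / Real.pi < c) (hc2 : c < 1)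
    (k' : ℕ) (hk' : k' = 0 ∨ k' = 4 ∨ k' = 6 ∨ k' = 8 ∨ k' = 10 ∨ k' = 14) :
    ∃ L : ℕ, ∀ ℓ : ℕ, L < ℓ → ∀ m : ℕ, c * (ℓ : ℝ) < (m : ℝ) → m < ℓ →
      ∀ (f : ℂ → ℂ) (F : Polynomial ℂ),
        IsMillerForm ℓ k' m f → IsFaber ℓ k' m f F →
          ∃ x ∈ F.roots, ¬ ∃ r : ℝ, r ∈ Set.Icc (0 : ℝ) 1728 ∧ x = (r : ℂ) := by
  obtain ⟨B, n, hB, hS, hA⟩ := conc hc1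
  obtain ⟨γ1, h1⟩ := root_sum hk' ((X + C (B : ℂ)) ^ n)
  obtain ⟨γ2, h2⟩ := root_sum hk' X
  simp only [eval_pow, eval_add, eval_X, eval_C] at h1 h2
  have c1 := ct1 B n
  have c2 := ct2 B n
  set S := ∫ θ in (π/3)..(2*π/3), (aJ θ + B) ^ n * Real.sin θ
  set A := ∫ θ in (π/3)..(2*π/3), (aJ θ + B) ^ n
  set J := lineInt jinv 1 with hJ
  have hδ : 0 < c * S - 3 / π * A := by linarith
  obtain ⟨L1, hL1⟩ := exists_nat_gt (γ1.re / (c * S - 3 / π * A))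
  obtain ⟨L2, hL2⟩ := exists_nat_gt ((n * |J.re| + γ2.re) / 24)
  refine ⟨max L1 L2, fun ℓ hℓ m hm hml f F hf hF => ?_⟩
  by_contra hcon
  push Not at hcon
  have hl1 : (L1 : ℝ) < ℓ := by exact_mod_cast (le_max_left _ _).trans_lt hℓ
  have hl2 : (L2 : ℝ) < ℓ := by exact_mod_cast (le_max_right _ _).trans_lt hℓ
  by_cases hD : n ≤ ℓ - m
  · have e := h1 ℓ m f F hml hf hF (by
      refine (natDegree_pow_le).trans ?_
      rw [natDegree_X_add_C]; omega)
    have hpos := re_sum_nonneg F.roots ((X + C (B : ℂ)) ^ n) (fun x hx => by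
      obtain ⟨r, hr, rfl⟩ := hcon x hx
      have : (((X + C (B : ℂ)) ^ n).eval (r : ℂ)) = (((r + B) ^ n : ℝ) : ℂ) := by simp
      rw [this, Complex.ofReal_re]
      have := hr.1
      positivity)
    simp only [eval_pow, eval_add, eval_X, eval_C] at hpos
    rw [e] at hpos
    simp only [Complex.add_re, Complex.sub_re, Complex.mul_re, Complex.natCast_re, Complex.natCast_im, zero_mul,
      sub_zero, c1, c2] at hpos
    have h3 : γ1.re < ℓ * (c * S - 3 / π * A) := by
      rw [div_lt_iff₀ hδ] at hL1
      nlinarith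
    nlinarith
  · have hn1 : 1 ≤ ℓ - m := by omega
    have e := h2 ℓ m f F hml hf hF (by rw [natDegree_X]; exact hn1)
    have hpos := re_sum_nonneg F.roots X (fun x hx => by
      obtain ⟨r, hr, rfl⟩ := hcon x hx
      simpa using hr.1)
    simp only [eval_X] at hpos
    rw [e, lineInt_jE2, ← hJ] at hpos
    simp only [Complex.add_re, Complex.sub_re, Complex.mul_re, Complex.natCast_re, Complex.natCast_im, zero_mul,
      sub_zero] at hpos
    have h4 : ((24 : ℂ)).re = 24 := by simp
    rw [h4] at hpos
    have h5 : (ℓ : ℝ) - m ≤ n := by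
      have : ℓ ≤ n + m := by omega
      have : (ℓ : ℝ) ≤ n + m := by exact_mod_cast this
      linarith
    have h6 : (0 : ℝ) ≤ ℓ - m := by
      have : (m : ℝ) < ℓ := by exact_mod_cast hml
      linarith
    have h7 : ((ℓ : ℝ) - m) * J.re ≤ n * |J.re| :=
      (mul_le_mul_of_nonneg_left (le_abs_self _) h6).trans (mul_le_mul_of_nonneg_right h5 (abs_nonneg _))
    rw [div_lt_iff₀ (by norm_num)] at hL2
    nlinarith
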